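/- Let L be a non-contractible compact metric ANR. Suppose C is a metric continuum with 1 ≤ n = L-dim C < ∞. For each ordinal α ≥ n, there exists a compact Fréchet space X such that: (a) L-dim X = n; (b) L-Ind X = α; and (c) each connected component of X is homeomorphic to C. -/

import Mathlib

open Set Topology Cardinal

noncomputable section

attribute [local instance] Classical.propDecidable

/-- Values of dimension functions: `⊥ : WithBot Ordinal.{0}` encodes `−1`,
ordinals are the usual values, and `⊤` encodes `∞`. -/
abbrev Dim : Type 1 := WithTop (WithBot Ordinal.{0})

/-- An ordinal viewed as a dimension value. -/
def Dim.ofOrdinal (a : Ordinal.{0}) : Dim := ((a : WithBot Ordinal.{0}) : Dim)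

/-- The dimension value `−1`. -/
def Dim.minusOne : Dim := ((⊥ : WithBot Ordinal.{0}) : Dim)

/-- An integer `m ≥ −1` viewed as a dimension value. -/
def Dim.ofInt (m : ℤ) : Dim := if 0 ≤ m then Dim.ofOrdinal m.toNat else Dim.minusOne

/-- `A` is a `K`-tuple for the simplicial complex `K` on the vertex set `Fin m`:
whenever the members indexed by a nonempty `I` have a common point, `I` spans a
simplex of `K`. -/
def IsKTuple {m : ℕ} (K : Finset (Fin m) → Prop) {X : Type} (A : Fin m → Set X) : Prop :=
  ∀ I : Finset (Fin m), I.Nonempty → (⋂ i ∈ I, A i).Nonempty → K I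

/-- `K` is an abstract (finite) simplicial complex with vertex set `Fin m`:
it is closed under passing to nonempty subsets, and contains every vertex. -/
def IsComplex {m : ℕ} (K : Finset (Fin m) → Prop) : Prop :=
  (∀ s t : Finset (Fin m), s ⊆ t → s.Nonempty → K t → K s) ∧ ∀ i, K {i}

/-- The boundary complex `∂Δ^k` of the `k`-simplex: all proper subsets of the
`k+1` vertices span simplices. -/
def bComplex (k : ℕ) : Finset (Fin (k + 1)) → Prop := fun s => s ≠ Finset.univ

/-- `U` is an (open) `K`-neighbourhood of the tuple `F`. -/
def KNbhd {m : ℕ} (K : Finset (Fin m) → Prop) {X : Type} [TopologicalSpace X]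
    (F U : Fin m → Set X) : Prop :=
  (∀ i, IsOpen (U i)) ∧ IsKTuple K U ∧ ∀ i, F i ⊆ U i

/-- Auxiliary form of `K-Ind X ≤ α`, defined by transfinite recursion on `α`:
every closed `K`-tuple has a `K`-neighbourhood whose corresponding `K`-partition
is either empty (dimension `−1`) or has `K-Ind < α`. -/
def KIndLeAux {m : ℕ} (K : Finset (Fin m) → Prop) :
    Ordinal.{0} → ∀ X : Type, TopologicalSpace X → Prop :=
  (wellFounded_lt (α := Ordinal.{0})).fix fun α rec X tX =>
    letI := tX
    ∀ F : Fin m → Set X, (∀ i, IsClosed (F i)) → IsKTuple K F →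
      ∃ U : Fin m → Set X, (∀ i, IsOpen (U i)) ∧ IsKTuple K U ∧ (∀ i, F i ⊆ U i) ∧
        ((⋃ i, U i)ᶜ = (∅ : Set X) ∨
          ∃ β : Set.Iio α, rec β.1 β.2 (↥((⋃ i, U i)ᶜ)) inferInstance)

/-- `K-Ind X ≤ α` (for an ordinal `α ≥ 0`). -/
def KIndLE {m : ℕ} (K : Finset (Fin m) → Prop) (X : Type) [tX : TopologicalSpace X]
    (α : Ordinal.{0}) : Prop :=
  KIndLeAux K α X tX

/-- Fedorchuk's inductive dimension `K-Ind` modulo a simplicial complex `K`;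
`−1` for the empty space, the least `α` with `K-Ind X ≤ α` otherwise, `∞` if none. -/
def KInd {m : ℕ} (K : Finset (Fin m) → Prop) (X : Type) [TopologicalSpace X] : Dim :=
  if IsEmpty X then Dim.minusOne
  else if ∃ α, KIndLE K X α then Dim.ofOrdinal (sInf {α | KIndLE K X α}) else ⊤

/-- The set of `K`-obstruction points of an open `K`-tuple `U`: points covered
by no `K`-neighbourhood of `U`. -/
def KObs {m : ℕ} (K : Finset (Fin m) → Prop) {X : Type} [TopologicalSpace X]
    (U : Fin m → Set X) : Set X :=
  {x | ¬ ∃ V : Fin m → Set X, KNbhd K U V ∧ x ∈ ⋃ i, V i}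

/-- `X` is strongly `α`-dimensional: `K-Ind X` is a positive ordinal `α` and some
closed `K`-tuple admits no `K`-neighbourhood `U` without obstruction points whose
corresponding `K`-partition has `K-Ind < α`. -/
def KStrongly {m : ℕ} (K : Finset (Fin m) → Prop) (X : Type) [TopologicalSpace X] : Prop :=
  (∃ α : Ordinal.{0}, 0 < α ∧ KInd K X = Dim.ofOrdinal α) ∧
  ∃ F : Fin m → Set X, (∀ i, IsClosed (F i)) ∧ IsKTuple K F ∧
    ∀ U : Fin m → Set X, KNbhd K F U →
      KInd K (↥((⋃ i, U i)ᶜ)) < KInd K X → KObs K U ≠ ∅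

/-- The dimensional strength degree `K-str X ∈ {0,1}`. -/
def KStr {m : ℕ} (K : Finset (Fin m) → Prop) (X : Type) [TopologicalSpace X] : ℕ :=
  if KStrongly K X then 1 else 0

/-- `K-dim X ≤ n`: any `n+1` closed `K`-tuples admit `K`-partitions with empty
intersection. -/
def KDimLE {m : ℕ} (K : Finset (Fin m) → Prop) (X : Type) [TopologicalSpace X] (n : ℕ) : Prop :=
  ∀ F : Fin (n + 1) → Fin m → Set X,
    (∀ j i, IsClosed (F j i)) → (∀ j, IsKTuple K (F j)) →
    ∃ U : Fin (n + 1) → Fin m → Set X, (∀ j, KNbhd K (F j) (U j)) ∧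
      (⋂ j, (⋃ i, U j i)ᶜ) = (∅ : Set X)

/-- Fedorchuk's dimension `K-dim` modulo a simplicial complex `K`. -/
def KDim {m : ℕ} (K : Finset (Fin m) → Prop) (X : Type) [TopologicalSpace X] : Dim :=
  if IsEmpty X then Dim.minusOne
  else if ∃ n, KDimLE K X n then Dim.ofOrdinal ((sInf {n | KDimLE K X n} : ℕ) : Ordinal.{0}) else ⊤

/-- `dim X ≤ n` for the Lebesgue covering dimension: every finite open cover has
an open shrinking of order at most `n+1`. -/
def CovDimLE (X : Type) [TopologicalSpace X] (n : ℕ) : Prop :=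
  ∀ (ι : Type), Finite ι → ∀ U : ι → Set X, (∀ i, IsOpen (U i)) → (⋃ i, U i) = Set.univ →
    ∃ V : ι → Set X, (∀ i, IsOpen (V i)) ∧ (∀ i, V i ⊆ U i) ∧ (⋃ i, V i) = Set.univ ∧
      ∀ x : X, ({i | x ∈ V i}).ncard ≤ n + 1

/-- The Lebesgue covering dimension. -/
def covDim (X : Type) [TopologicalSpace X] : Dim :=
  if IsEmpty X then Dim.minusOne
  else if ∃ n, CovDimLE X n then Dim.ofOrdinal ((sInf {n | CovDimLE X n} : ℕ) : Ordinal.{0}) else ⊤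

/-- `Ind X ≤ n` for the large inductive dimension, by recursion on `n`. -/
def IndLE : ℕ → ∀ X : Type, TopologicalSpace X → Prop
  | 0, X, tX =>
    letI := tX
    ∀ F U : Set X, IsClosed F → IsOpen U → F ⊆ U →
      ∃ V : Set X, IsOpen V ∧ F ⊆ V ∧ V ⊆ U ∧ frontier V = ∅
  | n + 1, X, tX =>
    letI := tX
    ∀ F U : Set X, IsClosed F → IsOpen U → F ⊆ U →
      ∃ V : Set X, IsOpen V ∧ F ⊆ V ∧ V ⊆ U ∧ IndLE n (↥(frontier V)) inferInstance

/-- The large inductive dimension `Ind`. -/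
def IndDim (X : Type) [tX : TopologicalSpace X] : Dim :=
  if IsEmpty X then Dim.minusOne
  else if ∃ n, IndLE n X tX then Dim.ofOrdinal ((sInf {n | IndLE n X tX} : ℕ) : Ordinal.{0}) else ⊤

/-- The relation generating the topological join `A ∗ B`: the copy of `B` is
collapsed at parameter `0`, the copy of `A` at parameter `1`. -/
def JoinRel (A B : Type) : (A × B × unitInterval) → (A × B × unitInterval) → Prop :=
  fun p q => (p.2.2 = 0 ∧ q.2.2 = 0 ∧ p.1 = q.1) ∨ (p.2.2 = 1 ∧ q.2.2 = 1 ∧ p.2.1 = q.2.1)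

/-- The topological join `A ∗ B`. -/
abbrev Join (A B : Type) [TopologicalSpace A] [TopologicalSpace B] : Type :=
  Quot (JoinRel A B)

/-- Auxiliary construction of the join of `n+1` copies of `L`, bundled with its
topology. -/
def JoinPowAux (L : Type) (tL : TopologicalSpace L) : ℕ → (T : Type) × TopologicalSpace T
  | 0 => ⟨L, tL⟩
  | n + 1 =>
    let p := JoinPowAux L tL n
    letI := tL
    letI := p.2
    ⟨Join L p.1, inferInstance⟩

/-- The join `L ∗ ⋯ ∗ L` of `n+1` copies of `L`. -/
def JoinPow (L : Type) [tL : TopologicalSpace L] (n : ℕ) : Type :=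
  (JoinPowAux L tL n).1

instance joinPowTopologicalSpace (L : Type) [tL : TopologicalSpace L] (n : ℕ) :
    TopologicalSpace (JoinPow L n) :=
  (JoinPowAux L tL n).2

/-- `L-dim X ≤ n`: every continuous map from a closed subset of `X` to the join
of `n+1` copies of `L` extends continuously over `X`. -/
def LDimLE (L : Type) [TopologicalSpace L] (X : Type) [TopologicalSpace X] (n : ℕ) : Prop :=
  ∀ F : Set X, IsClosed F → ∀ f : C(F, JoinPow L n),
    ∃ g : C(X, JoinPow L n), ∀ x : F, g x = f x

/-- Fedorchuk's dimension `L-dim` modulo an ANR `L`. -/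
def LDim (L : Type) [TopologicalSpace L] (X : Type) [TopologicalSpace X] : Dim :=
  if IsEmpty X then Dim.minusOne
  else if ∃ n, LDimLE L X n then Dim.ofOrdinal ((sInf {n | LDimLE L X n} : ℕ) : Ordinal.{0}) else ⊤

/-- Auxiliary form of `L-Ind X ≤ α`, by transfinite recursion on `α`: every map
to `L` from a closed subset of `X` has an `L`-partition which is either empty or
has `L-Ind < α`. -/
def LIndLeAux (L : Type) [TopologicalSpace L] :
    Ordinal.{0} → ∀ X : Type, TopologicalSpace X → Prop :=
  (wellFounded_lt (α := Ordinal.{0})).fix fun α rec X tX =>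
    letI := tX
    ∀ F : Set X, IsClosed F → ∀ f : C(F, L),
      ∃ U : Set X, IsOpen U ∧ ∃ hFU : F ⊆ U,
        (∃ g : C(U, L), ∀ (x : X) (hx : x ∈ F), g ⟨x, hFU hx⟩ = f ⟨x, hx⟩) ∧
        (Uᶜ = (∅ : Set X) ∨ ∃ β : Set.Iio α, rec β.1 β.2 (↥(Uᶜ)) inferInstance)

/-- `L-Ind X ≤ α` (for an ordinal `α ≥ 0`). -/
def LIndLE (L : Type) [TopologicalSpace L] (X : Type) [tX : TopologicalSpace X]
    (α : Ordinal.{0}) : Prop :=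
  LIndLeAux L α X tX

/-- Fedorchuk's inductive dimension `L-Ind` modulo an ANR `L`. -/
def LInd (L : Type) [TopologicalSpace L] (X : Type) [TopologicalSpace X] : Dim :=
  if IsEmpty X then Dim.minusOne
  else if ∃ α, LIndLE L X α then Dim.ofOrdinal (sInf {α | LIndLE L X α}) else ⊤

/-- `L` is an absolute neighbourhood retract (for metric spaces): `L` is
metrizable and whenever a closed subset `A` of a metric space is homeomorphic to
`L` via `e`, the map `e` extends continuously over a neighbourhood of `A`. -/
def IsANR (L : Type) [TopologicalSpace L] : Prop :=
  TopologicalSpace.MetrizableSpace L ∧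
  ∀ (M : Type) [MetricSpace M], ∀ A : Set M, IsClosed A → ∀ e : A ≃ₜ L,
    ∃ U : Set M, IsOpen U ∧ ∃ hAU : A ⊆ U, ∃ r : C(U, L),
      ∀ (a : M) (ha : a ∈ A), r ⟨a, hAU ha⟩ = e ⟨a, ha⟩

/-- `L-Ind_{b+} X`: the least dimension value `d` such that some open
neighbourhood of `b` has closure of `L-Ind` at most `d`. -/
def LIndPlus (L : Type) [TopologicalSpace L] {X : Type} [TopologicalSpace X] (b : X) : Dim :=
  sInf {d : Dim | ∃ U : Set X, IsOpen U ∧ b ∈ U ∧ LInd L (↥(closure U)) ≤ d}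

/-- The set `K(X) = {b ∈ X : L-Ind_{b+} X = L-Ind X}`. -/
def LKset (L : Type) [TopologicalSpace L] (X : Type) [TopologicalSpace X] : Set X :=
  {b | LIndPlus L b = LInd L X}

/-- The weight of a topological space: the least cardinality of a basis. -/
def tWeight (X : Type) [TopologicalSpace X] : Cardinal :=
  sInf {c | ∃ B : Set (Set X), TopologicalSpace.IsTopologicalBasis B ∧ #B = c}

/-- The family `𝒮_X` of all subsets of `X` that are finite or homeomorphic to the
one-point compactification `A_{ℵ₀}` of a countably infinite discrete space. -/
def SFam (X : Type) [TopologicalSpace X] : Set (Set X) :=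
  {S | S.Finite ∨ Nonempty (↥S ≃ₜ OnePoint ℕ)}

/-- The relation generating the quotient `N` in the `Z(X,Y)` construction:
each set `{μ} × {x} × Y` is collapsed to a point. -/
def ZRel (ι X Y : Type) : (OnePoint ι × X × Y) → (OnePoint ι × X × Y) → Prop :=
  fun p q => p.1 = OnePoint.infty ∧ q.1 = OnePoint.infty ∧ p.2.1 = q.2.1

/-- The quotient space `N` of `A_𝔪 × X × Y`. -/
abbrev ZQuot (ι X Y : Type) [TopologicalSpace ι] [TopologicalSpace X] [TopologicalSpace Y] :
    Type :=
  Quot (ZRel ι X Y)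

/-- The subset `Z(X,Y) = ⋃_{α ∈ A_𝔪} H(α)` of `N`:  `H(μ) = π₁({μ} × X × Y)` and
`H(α) = π₁({α} × φ(α) × Y)` for `α ≠ μ`. -/
def ZSet (ι X Y : Type) [TopologicalSpace ι] [TopologicalSpace X] [TopologicalSpace Y]
    (φ : ι → Set X) : Set (ZQuot ι X Y) :=
  {z | ∃ p : OnePoint ι × X × Y, Quot.mk (ZRel ι X Y) p = z ∧
        (p.1 = OnePoint.infty ∨ ∃ i : ι, p.1 = (i : OnePoint ι) ∧ p.2.1 ∈ φ i)}

/-- The space `Z(X,Y)` (for the data `ι`, `φ`), with the subspace topology. -/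
abbrev ZSpace (ι X Y : Type) [TopologicalSpace ι] [TopologicalSpace X] [TopologicalSpace Y]
    (φ : ι → Set X) : Type :=
  ↥(ZSet ι X Y φ)

/-- The subset `H(μ)` of `Z(X,Y)`. -/
def ZHmu (ι X Y : Type) [TopologicalSpace ι] [TopologicalSpace X] [TopologicalSpace Y]
    (φ : ι → Set X) : Set (ZSpace ι X Y φ) :=
  {z | ∃ (x : X) (y : Y), (z : ZQuot ι X Y) = Quot.mk (ZRel ι X Y) (OnePoint.infty, x, y)}

/-- The projection `π_X : N → X`, `π₁(α,x,y) ↦ x`. -/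
def ZQuotProjX {ι X Y : Type} [TopologicalSpace ι] [TopologicalSpace X] [TopologicalSpace Y] :
    ZQuot ι X Y → X :=
  Quot.lift (fun p => p.2.1) (fun _ _ h => h.2.2)

/-- The projection `π_X : Z(X,Y) → X`. -/
def ZProjX {ι X Y : Type} [TopologicalSpace ι] [TopologicalSpace X] [TopologicalSpace Y]
    (φ : ι → Set X) : ZSpace ι X Y φ → X :=
  fun z => ZQuotProjX (z : ZQuot ι X Y)

/-- The cardinality requirements on the index set `ι` (of cardinality `𝔪`) in the
`Z(X,Y)` construction: `𝔪 ≥ max {ℵ₀, (wX)⁺, (wY)⁺, card 𝒮_X}`. -/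
def ZCardOK (X Y ι : Type) [TopologicalSpace X] [TopologicalSpace Y] : Prop :=
  ℵ₀ ≤ #ι ∧ tWeight X < #ι ∧ tWeight Y < #ι ∧ #(SFam X) ≤ #ι

/-- The requirements on `φ : A_𝔪 \ {μ} → 𝒮_X`: it takes values in `𝒮_X` and every
fibre has cardinality `𝔪`. -/
def ZPhiOK {X ι : Type} [TopologicalSpace X] (φ : ι → Set X) : Prop :=
  (∀ i, φ i ∈ SFam X) ∧ ∀ S ∈ SFam X, #(↥(φ ⁻¹' {S})) = #ι


/-- Every partial map from a closed subset of `X` to `Y` extends over `X`. -/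
def EP (Y X : Type) [TopologicalSpace Y] [TopologicalSpace X] : Prop :=
  ∀ F : Set X, IsClosed F → ∀ f : X → Y, ContinuousOn f F →
    ∃ g : X → Y, Continuous g ∧ EqOn g f F

/-- `Y` is a neighbourhood extensor for normal spaces. -/
def NE (Y : Type) [TopologicalSpace Y] : Prop :=
  ∀ (X : Type) [TopologicalSpace X] [NormalSpace X] (F : Set X), IsClosed F →
    ∀ f : X → Y, ContinuousOn f F →
    ∃ U : Set X, IsOpen U ∧ F ⊆ U ∧ ∃ g : X → Y, ContinuousOn g U ∧ EqOn g f F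

/-- `Y` is a neighbourhood extensor for metrizable spaces. -/
def ME (Y : Type) [TopologicalSpace Y] : Prop :=
  ∀ (X : Type) [TopologicalSpace X] [TopologicalSpace.MetrizableSpace X] (F : Set X), IsClosed F →
    ∀ f : X → Y, ContinuousOn f F →
    ∃ U : Set X, IsOpen U ∧ F ⊆ U ∧ ∃ g : X → Y, ContinuousOn g U ∧ EqOn g f F

/-- `Y` injects continuously in the countable power of the reals. -/
def EmbR (Y : Type) [TopologicalSpace Y] : Prop :=
  ∃ e : Y → (ℕ → ℝ), Continuous e ∧ Function.Injective e

theorem exists_total {X Y : Type} [TopologicalSpace X] [TopologicalSpace Y] [hY : Nonempty Y]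
    (U : Set X) (r : U → Y) (hr : Continuous r) :
    ∃ g : X → Y, ContinuousOn g U ∧ ∀ x : U, g x = r x := by
  refine ⟨fun x => if h : x ∈ U then r ⟨x, h⟩ else Classical.choice hY, ?_, ?_⟩
  · rw [continuousOn_iff_continuous_domRestrict]
    convert hr using 1
    ext x
    simp
  · intro x
    simp

theorem tietze_total {X Y : Type} [TopologicalSpace X] [NormalSpace X] [TopologicalSpace Y]
    [TietzeExtension.{0,0} Y] (F : Set X) (hF : IsClosed F) (f : X → Y) (hf : ContinuousOn f F) :
    ∃ g : X → Y, Continuous g ∧ EqOn g f F := by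
  obtain ⟨g, hg⟩ := ContinuousMap.exists_restrict_eq hF
    (⟨F.domRestrict f, continuousOn_iff_continuous_domRestrict.1 hf⟩ : C(F, Y))
  refine ⟨g, g.continuous, fun x hx => ?_⟩
  exact congrArg (fun k : C(F, Y) => k ⟨x, hx⟩) hg

theorem NE_of_retract {Y : Type} [TopologicalSpace Y] (e : Y → (ℕ → ℝ)) (he : Continuous e)
    (O : Set (ℕ → ℝ)) (hO : IsOpen O) (hr : range e ⊆ O)
    (s : (ℕ → ℝ) → Y) (hs : ContinuousOn s O) (hse : ∀ y, s (e y) = y) : NE Y := by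
  intro X _ _ F hF f hf
  obtain ⟨G, hG, hGf⟩ := tietze_total F hF (e ∘ f) (he.comp_continuousOn hf)
  refine ⟨G ⁻¹' O, hO.preimage hG, ?_, s ∘ G, ?_, ?_⟩
  · intro x hx
    have := hGf hx
    simp only [mem_preimage, this]
    exact hr ⟨_, rfl⟩
  · exact hs.comp hG.continuousOn (fun x hx => hx)
  · intro x hx
    simp only [Function.comp, hGf hx, hse]

theorem exists_inv_continuousOn {Y : Type} [TopologicalSpace Y] [CompactSpace Y] [Nonempty Y]
    (e : Y → (ℕ → ℝ)) (he : Continuous e) (hi : Function.Injective e) :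
    IsClosed (range e) ∧ ContinuousOn (Function.invFun e) (range e) := by
  have hc := he.isClosedEmbedding hi
  refine ⟨hc.isClosed_range, ?_⟩
  rw [continuousOn_iff_continuous_domRestrict]
  have h1 := (hc.isEmbedding.toHomeomorph).symm.continuous
  convert h1 using 1
  ext ⟨_, y, rfl⟩
  rw [Set.domRestrict_apply]
  rw [Function.leftInverse_invFun hi y]
  symm
  rw [Homeomorph.symm_apply_eq]
  rfl

theorem NE_of_ME {Y : Type} [TopologicalSpace Y] [CompactSpace Y] [Nonempty Y]
    (hY : EmbR Y) (h : ME Y) : NE Y := by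
  obtain ⟨e, he, hi⟩ := hY
  obtain ⟨hcl, hco⟩ := exists_inv_continuousOn e he hi
  obtain ⟨U, hU, hFU, g, hg, hgf⟩ := h (ℕ → ℝ) (range e) hcl _ hco
  refine NE_of_retract e he U hU hFU g hg fun y => ?_
  rw [hgf ⟨y, rfl⟩, Function.leftInverse_invFun hi y]

theorem ME_of_NE {Y : Type} [TopologicalSpace Y] (h : NE Y) : ME Y := by
  intro X _ _ F hF f hf
  let _ := TopologicalSpace.metrizableSpaceMetric X
  exact h X F hF f hf

theorem EmbR_of_metric (Y : Type) [MetricSpace Y] [CompactSpace Y] [Nonempty Y] : EmbR Y := by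
  refine ⟨fun y n => dist y (TopologicalSpace.denseSeq Y n), by fun_prop, ?_⟩
  intro x y hxy
  by_contra hne
  have hd : 0 < dist x y := dist_pos.2 hne
  obtain ⟨n, hn⟩ := (TopologicalSpace.denseRange_denseSeq Y).exists_dist_lt x (half_pos hd)
  have h1 := congrFun hxy n
  simp only at h1
  have h2 := dist_triangle x (TopologicalSpace.denseSeq Y n) y
  rw [dist_comm (TopologicalSpace.denseSeq Y n) y] at h2
  linarith

theorem NE_of_IsANR (L : Type) [MetricSpace L] [CompactSpace L] [Nonempty L] (h : IsANR L) :
    NE L := by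
  obtain ⟨e, he, hi⟩ := EmbR_of_metric L
  have hc := he.isClosedEmbedding hi
  let _ : MetricSpace (ℕ → ℝ) := TopologicalSpace.metrizableSpaceMetric (ℕ → ℝ)
  obtain ⟨U, hU, hAU, r, hr⟩ := h.2 (ℕ → ℝ) (range e) hc.isClosed_range hc.isEmbedding.toHomeomorph.symm
  obtain ⟨g, hg, hgr⟩ := exists_total U r r.continuous
  refine NE_of_retract e he U hU hAU g hg fun y => ?_
  have h1 := hr (e y) ⟨y, rfl⟩
  have h2 := hgr ⟨e y, hAU ⟨y, rfl⟩⟩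
  rw [h2, h1, Homeomorph.symm_apply_eq]
  rfl

/-- Relative version of `ME` in an open subset. -/
theorem ME_open {Y : Type} [TopologicalSpace Y] [Nonempty Y] (h : ME Y) {X : Type}
    [TopologicalSpace X] [TopologicalSpace.MetrizableSpace X] (O F : Set X) (hO : IsOpen O)
    (hF : IsClosed F) (f : X → Y) (hf : ContinuousOn f (F ∩ O)) :
    ∃ U : Set X, IsOpen U ∧ F ∩ O ⊆ U ∧ U ⊆ O ∧
      ∃ g : X → Y, ContinuousOn g U ∧ EqOn g f (F ∩ O) := by
  obtain ⟨U, hU, hFU, g, hg, hgf⟩ := h O (((↑) : O → X) ⁻¹' F) (hF.preimage continuous_subtype_val)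
    (f ∘ (↑)) (hf.comp continuous_subtype_val.continuousOn (fun x hx => ⟨hx, x.2⟩))
  have hop : IsOpen (((↑) : O → X) '' U) := hO.isOpenMap_subtype_val _ hU
  have hc : Continuous (fun x : (((↑) : O → X) '' U) =>
      g ⟨x.1, by obtain ⟨y, _, hy⟩ := x.2; rw [← hy]; exact y.2⟩) := by
    have h2 : ContinuousOn g U := hg
    refine h2.comp_continuous (f := fun x : (((↑) : O → X) '' U) =>
      (⟨x.1, by obtain ⟨y, _, hy⟩ := x.2; rw [← hy]; exact y.2⟩ : O)) (by fun_prop) ?_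
    rintro ⟨_, y, hy, rfl⟩
    exact hy
  obtain ⟨g', hg', hgg⟩ := exists_total _ _ hc
  refine ⟨_, hop, ?_, ?_, g', hg', ?_⟩
  · intro x hx
    exact ⟨⟨x, hx.2⟩, hFU hx.1, rfl⟩
  · rintro _ ⟨y, _, rfl⟩
    exact y.2
  · intro x hx
    have h1 := hgg ⟨x, ⟨⟨x, hx.2⟩, hFU hx.1, rfl⟩⟩
    simp only at h1
    rw [h1]
    exact hgf (show (⟨x, hx.2⟩ : O) ∈ _ from hx.1)

/-- Gluing two functions along relatively closed sets. -/
theorem glue_closed {X Y : Type} [TopologicalSpace X] [TopologicalSpace Y] {S A B : Set X}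
    (hA : IsClosed A) (hB : IsClosed B) (hS : S ⊆ A ∪ B) (f g : X → Y)
    (hf : ContinuousOn f (S ∩ A)) (hg : ContinuousOn g (S ∩ B))
    (hfg : EqOn f g (S ∩ A ∩ B)) :
    ∃ k : X → Y, ContinuousOn k S ∧ EqOn k f (S ∩ A) ∧ EqOn k g (S ∩ B) := by
  have h1 : EqOn (fun x => if x ∈ A then f x else g x) f (S ∩ A) := by
    intro x hx; simp [hx.2]
  have h2 : EqOn (fun x => if x ∈ A then f x else g x) g (S ∩ B) := by
    intro x hx
    by_cases h : x ∈ A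
    · simp only [h, if_true]; exact hfg ⟨⟨hx.1, h⟩, hx.2⟩
    · simp [h]
  refine ⟨_, ?_, h1, h2⟩
  have hc1 := hf.congr h1
  have hc2 := hg.congr h2
  have : S = (S ∩ A) ∪ (S ∩ B) := by
    rw [← inter_union_distrib_left]; exact (inter_eq_left.2 hS).symm
  rw [this]
  intro x hx
  have hxS : x ∈ S := by rcases hx with h | h <;> exact h.1
  apply ContinuousWithinAt.union
  · by_cases h : x ∈ A
    · exact hc1 x ⟨hxS, h⟩
    · apply continuousWithinAt_of_notMem_closure
      intro hcl
      exact h (closure_minimal inter_subset_right hA hcl)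
  · by_cases h : x ∈ B
    · exact hc2 x ⟨hxS, h⟩
    · apply continuousWithinAt_of_notMem_closure
      intro hcl
      exact h (closure_minimal inter_subset_right hB hcl)

/-- Gluing two functions on closed sets. -/
theorem glue_closed' {X Y : Type} [TopologicalSpace X] [TopologicalSpace Y] {A B : Set X}
    (hA : IsClosed A) (hB : IsClosed B) (f g : X → Y)
    (hf : ContinuousOn f A) (hg : ContinuousOn g B)
    (hfg : EqOn f g (A ∩ B)) :
    ∃ k : X → Y, ContinuousOn k (A ∪ B) ∧ EqOn k f A ∧ EqOn k g B := by
  obtain ⟨k, h1, h2, h3⟩ := glue_closed (S := A ∪ B) hA hB Subset.rfl f g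
    (hf.mono inter_subset_right) (hg.mono inter_subset_right)
    (fun x hx => hfg ⟨hx.1.2, hx.2⟩)
  exact ⟨k, h1, fun x hx => h2 ⟨Or.inl hx, hx⟩, fun x hx => h3 ⟨Or.inr hx, hx⟩⟩

/-- Homotopy extension (end map only). -/
theorem homotopy_ext {Y X : Type} [TopologicalSpace Y] [TopologicalSpace X] (hY : NE Y)
    [CompactSpace X] [T2Space X] (A : Set X) (hA : IsClosed A) (H : X × unitInterval → Y)
    (hH : ContinuousOn H (A ×ˢ Set.univ)) (b : X → Y) (hb : Continuous b)
    (h0 : ∀ x ∈ A, H (x, 0) = b x) :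
    ∃ g : X → Y, Continuous g ∧ ∀ x ∈ A, g x = H (x, 1) := by
  have hc0 : IsClosed ((Set.univ : Set X) ×ˢ ({0} : Set unitInterval)) :=
    isClosed_univ.prod isClosed_singleton
  have hc1 : IsClosed (A ×ˢ (Set.univ : Set unitInterval)) := hA.prod isClosed_univ
  obtain ⟨k, hk, hk0, hk1⟩ := glue_closed' hc0 hc1 (b ∘ Prod.fst) H
    (hb.comp continuous_fst).continuousOn hH (by
      rintro ⟨x, s⟩ ⟨⟨_, hs⟩, hx, _⟩
      simp only [mem_singleton_iff] at hs
      subst hs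
      exact (h0 x hx).symm)
  obtain ⟨U, hU, hFU, g, hg, hgk⟩ := hY (X × unitInterval) _ (hc0.union hc1) k hk
  -- the closed set of bad points
  have hbad : IsClosed (Prod.fst '' Uᶜ : Set X) :=
    (hU.isClosed_compl.isCompact.image continuous_fst).isClosed
  have hdisj : Disjoint A (Prod.fst '' Uᶜ : Set X) := by
    rw [Set.disjoint_left]
    rintro x hx ⟨⟨y, s⟩, hy, rfl⟩
    exact hy (hFU (Or.inr ⟨hx, mem_univ _⟩))
  obtain ⟨u, hu, huI⟩ := tietze_total (Y := unitInterval) _ (hA.union hbad)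
    (fun x => if x ∈ A then 1 else 0) (by
      apply ContinuousOn.union_of_isClosed _ _ hA hbad
      · exact (continuousOn_const (c := (1 : unitInterval))).congr (fun x hx => by simp [hx])
      · exact (continuousOn_const (c := (0 : unitInterval))).congr (fun x hx => by
          have : x ∉ A := fun h => Set.disjoint_left.1 hdisj h hx
          simp [this]))
  have hmem : ∀ x, (x, u x) ∈ U := by
    intro x
    by_contra hx
    have h2 : x ∈ (Prod.fst '' Uᶜ : Set X) := ⟨_, hx, rfl⟩
    have h1 : x ∉ A := fun h => Set.disjoint_left.1 hdisj h h2
    have h3 := huI (Or.inr h2)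
    simp only [h1, if_false] at h3
    apply hx
    rw [h3]
    exact hFU (Or.inl ⟨mem_univ _, rfl⟩)
  refine ⟨fun x => g (x, u x), hg.comp_continuous (by fun_prop) hmem, fun x hx => ?_⟩
  have h3 := huI (Or.inl hx)
  simp only [hx, if_true] at h3
  simp only [h3]
  rw [hgk (Or.inr ⟨hx, mem_univ _⟩), hk1 ⟨hx, mem_univ _⟩]

/-- Maps close to an extendable map are extendable. -/
theorem close_ext {Y : Type} [MetricSpace Y] [CompactSpace Y] (hY : NE Y) :
    ∃ ε > 0, ∀ (X : Type) [TopologicalSpace X] [CompactSpace X] [T2Space X] (A : Set X),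
      IsClosed A → ∀ (a b : X → Y), ContinuousOn a A → Continuous b →
      (∀ x ∈ A, dist (a x) (b x) < ε) → ∃ g : X → Y, Continuous g ∧ EqOn g a A := by
  let Q := (Y × Y) × unitInterval
  let D0 : Set Q := Set.univ ×ˢ {0}
  let D1 : Set Q := Set.univ ×ˢ {1}
  let DD : Set Q := (diagonal Y) ×ˢ Set.univ
  have c0 : IsClosed D0 := isClosed_univ.prod isClosed_singleton
  have c1 : IsClosed D1 := isClosed_univ.prod isClosed_singleton
  have cD : IsClosed DD := isClosed_diagonal.prod isClosed_univ
  obtain ⟨k, hk, hk0, hk1⟩ := glue_closed' c0 c1 (fun q : Q => q.1.1) (fun q : Q => q.1.2)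
    (by fun_prop) (by fun_prop) (by
      rintro ⟨x, s⟩ ⟨⟨_, h⟩, _, h'⟩
      simp only [mem_singleton_iff] at h h'
      rw [h] at h'
      exact absurd h' zero_ne_one)
  obtain ⟨l, hl, hl0, hl1⟩ := glue_closed' (c0.union c1) cD k (fun q : Q => q.1.1) hk
    (by fun_prop) (by
      rintro ⟨⟨x, y⟩, s⟩ ⟨h | h, h2, _⟩
      · exact hk0 h
      · rw [hk1 h]; exact (h2 : x = y).symm)
  obtain ⟨U, hU, hFU, g, hg, hgl⟩ := hY Q _ ((c0.union c1).union cD) l hl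
  have hbad : IsCompact (Prod.fst '' Uᶜ : Set (Y × Y)) :=
    (hU.isClosed_compl.isCompact.image continuous_fst)
  have hop : IsOpen (Prod.fst '' Uᶜ : Set (Y × Y))ᶜ := hbad.isClosed.isOpen_compl
  have hsub : diagonal Y ⊆ (Prod.fst '' Uᶜ : Set (Y × Y))ᶜ := by
    rintro p hp ⟨⟨p', s⟩, hy, rfl⟩
    exact hy (hFU (Or.inr ⟨hp, mem_univ _⟩))
  have hmem : (Prod.fst '' Uᶜ : Set (Y × Y))ᶜ ∈ uniformity Y := by
    rw [← nhdsSet_diagonal_eq_uniformity]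
    exact hop.mem_nhdsSet.2 hsub
  obtain ⟨ε, hε, hεs⟩ := Metric.mem_uniformity_dist.1 hmem
  refine ⟨ε, hε, ?_⟩
  intro X _ _ _ A hA a b ha hb hab
  have hUm : ∀ x ∈ A, ∀ s : unitInterval, (((b x, a x), s) : Q) ∈ U := by
    intro x hx s
    by_contra h
    have h1 := hab x hx
    rw [dist_comm] at h1
    exact hεs h1 ⟨_, h, rfl⟩
  obtain ⟨G, hG, hGA⟩ := homotopy_ext hY A hA (fun p => g ((b p.1, a p.1), p.2)) (by
      apply hg.comp
      · apply ContinuousOn.prodMk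
        · apply ContinuousOn.prodMk
          · fun_prop
          · exact ha.comp continuous_fst.continuousOn (fun p hp => hp.1)
        · fun_prop
      · rintro ⟨x, s⟩ ⟨hx, _⟩
        exact hUm x hx s) b hb (by
      intro x hx
      have hm : (((b x, a x), 0) : Q) ∈ D0 := ⟨mem_univ _, rfl⟩
      simp only
      rw [hgl (Or.inl (Or.inl hm)), hl0 (Or.inl hm), hk0 hm])
  refine ⟨G, hG, fun x hx => ?_⟩
  have hm : (((b x, a x), 1) : Q) ∈ D1 := ⟨mem_univ _, rfl⟩
  rw [hGA x hx]
  simp only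
  rw [hgl (Or.inl (Or.inr hm)), hl0 (Or.inr hm), hk1 hm]


section joins

variable {A B : Type} [TopologicalSpace A] [TopologicalSpace B]

def jT : Join A B → unitInterval :=
  Quot.lift (fun p => p.2.2) (by
    rintro p q (⟨h1, h2, _⟩ | ⟨h1, h2, _⟩)
    · rw [h1, h2]
    · rw [h1, h2])

def jA [Nonempty A] : Join A B → A :=
  Quot.lift (fun p => if p.2.2 = 1 then Classical.arbitrary A else p.1) (by
    rintro p q (⟨h1, h2, h3⟩ | ⟨h1, h2, h3⟩)
    · simp [h1, h2, h3]
    · simp [h1, h2])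

def jB [Nonempty B] : Join A B → B :=
  Quot.lift (fun p => if p.2.2 = 0 then Classical.arbitrary B else p.2.1) (by
    rintro p q (⟨h1, h2, h3⟩ | ⟨h1, h2, h3⟩)
    · simp [h1, h2]
    · simp [h1, h2, h3])

def jmk (a : A) (b : B) (t : unitInterval) : Join A B := Quot.mk _ (a, b, t)

theorem jT_jmk (a : A) (b : B) (t : unitInterval) : jT (jmk a b t) = t := rfl

theorem jmk_congr {a a' : A} {b b' : B} {t : unitInterval} (ha : t ≠ 1 → a = a')
    (hb : t ≠ 0 → b = b') : jmk a b t = jmk a' b' t := by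
  by_cases h1 : t = 1
  · have h0 : t ≠ 0 := by rw [h1]; exact one_ne_zero
    exact Quot.sound (Or.inr ⟨h1, h1, hb h0⟩)
  · by_cases h0 : t = 0
    · exact Quot.sound (Or.inl ⟨h0, h0, ha h1⟩)
    · rw [ha h1, hb h0]

theorem jA_jmk [Nonempty A] (a : A) (b : B) (t : unitInterval) (h : t ≠ 1) :
    jA (jmk a b t) = a := by
  show (if t = 1 then Classical.arbitrary A else a) = a
  simp [h]

theorem jB_jmk [Nonempty B] (a : A) (b : B) (t : unitInterval) (h : t ≠ 0) :
    jB (jmk a b t) = b := by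
  show (if t = 0 then Classical.arbitrary B else b) = b
  simp [h]

theorem jmk_eta [Nonempty A] [Nonempty B] (q : Join A B) : jmk (jA q) (jB q) (jT q) = q := by
  obtain ⟨⟨a, b, t⟩, rfl⟩ := Quot.exists_rep q
  exact jmk_congr (fun h => jA_jmk a b t h) (fun h => jB_jmk a b t h)

theorem continuous_jT : Continuous (jT : Join A B → unitInterval) :=
  continuous_quot_lift _ (by fun_prop)

theorem continuousOn_jA [Nonempty A] : ContinuousOn (jA : Join A B → A) {q | jT q ≠ 1} := by
  have ho : IsOpen {q : Join A B | jT q ≠ 1} := (isOpen_compl_singleton (x := (1 : unitInterval))).preimage continuous_jT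
  rw [(isQuotientMap_quot_mk (r := JoinRel A B)).continuousOn_isOpen_iff ho]
  refine (continuous_fst.continuousOn).congr ?_
  rintro ⟨a, b, t⟩ h
  exact jA_jmk a b t h

theorem continuousOn_jB [Nonempty B] : ContinuousOn (jB : Join A B → B) {q | jT q ≠ 0} := by
  have ho : IsOpen {q : Join A B | jT q ≠ 0} := (isOpen_compl_singleton (x := (0 : unitInterval))).preimage continuous_jT
  rw [(isQuotientMap_quot_mk (r := JoinRel A B)).continuousOn_isOpen_iff ho]
  refine ((continuous_fst.comp continuous_snd).continuousOn).congr ?_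
  rintro ⟨a, b, t⟩ h
  exact jB_jmk a b t h

theorem continuousOn_jmk [CompactSpace A] [CompactSpace B] {X : Type} [TopologicalSpace X]
    {S : Set X} {a : X → A} {b : X → B} {t : X → unitInterval} (ht : ContinuousOn t S)
    (ha : ContinuousOn a (S ∩ {x | t x ≠ 1})) (hb : ContinuousOn b (S ∩ {x | t x ≠ 0})) :
    ContinuousOn (fun x => jmk (a x) (b x) (t x)) S := by
  have hmk : Continuous (fun p : A × B × unitInterval => jmk p.1 p.2.1 p.2.2) :=
    continuous_quot_mk
  intro x hx
  have ha' : t x ≠ 1 → ContinuousWithinAt a S x := by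
    intro h
    refine (ha x ⟨hx, h⟩).mono_of_mem_nhdsWithin ?_
    exact Filter.inter_mem self_mem_nhdsWithin
      ((ht x hx) (isOpen_compl_singleton.mem_nhds h))
  have hb' : t x ≠ 0 → ContinuousWithinAt b S x := by
    intro h
    refine (hb x ⟨hx, h⟩).mono_of_mem_nhdsWithin ?_
    exact Filter.inter_mem self_mem_nhdsWithin
      ((ht x hx) (isOpen_compl_singleton.mem_nhds h))
  by_cases h0 : t x = 0
  · have h1 : t x ≠ 1 := by rw [h0]; exact zero_ne_one
    intro O hO
    obtain ⟨O', hO'O, hO', hm⟩ := mem_nhds_iff.1 hO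
    have key : ∀ᶠ p : A × unitInterval in 𝓝 (a x, t x), ∀ y ∈ (Set.univ : Set B),
        jmk p.1 y p.2 ∈ O' := by
      apply isCompact_univ.eventually_forall_of_forall_eventually
      intro y _
      have hc : Continuous (fun z : (A × unitInterval) × B => jmk z.1.1 z.2 z.1.2) :=
        hmk.comp (by fun_prop : Continuous (fun z : (A × unitInterval) × B => (z.1.1, z.2, z.1.2)))
      refine hc.continuousAt.eventually (hO'.mem_nhds ?_)
      show jmk (a x) y (t x) ∈ O'
      rw [jmk_congr (a' := a x) (b' := b x) (fun _ => rfl) (fun h => absurd h0 h)]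
      exact hm
    have := (((ha' h1).prodMk (ht x hx)).eventually key)
    exact Filter.mem_map.2 (Filter.mem_of_superset this (fun z hz => hO'O (hz _ (mem_univ _))))
  · by_cases h1 : t x = 1
    · intro O hO
      obtain ⟨O', hO'O, hO', hm⟩ := mem_nhds_iff.1 hO
      have key : ∀ᶠ p : B × unitInterval in 𝓝 (b x, t x), ∀ y ∈ (Set.univ : Set A),
          jmk y p.1 p.2 ∈ O' := by
        apply isCompact_univ.eventually_forall_of_forall_eventually
        intro y _
        have hc : Continuous (fun z : (B × unitInterval) × A => jmk z.2 z.1.1 z.1.2) :=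
          hmk.comp (by fun_prop : Continuous (fun z : (B × unitInterval) × A => (z.2, z.1.1, z.1.2)))
        refine hc.continuousAt.eventually (hO'.mem_nhds ?_)
        show jmk y (b x) (t x) ∈ O'
        rw [jmk_congr (a' := a x) (b' := b x) (fun h => absurd h1 h) (fun _ => rfl)]
        exact hm
      have := (((hb' h0).prodMk (ht x hx)).eventually key)
      exact Filter.mem_map.2 (Filter.mem_of_superset this (fun z hz => hO'O (hz _ (mem_univ _))))
    · exact hmk.continuousAt.comp_continuousWithinAt
        ((ha' h1).prodMk ((hb' h0).prodMk (ht x hx)))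

end joins

theorem EmbR_of_countable {Y ι : Type} [TopologicalSpace Y] [Countable ι] [Nonempty ι]
    (e : Y → ι → ℝ) (he : Continuous e) (hi : Function.Injective e) : EmbR Y := by
  obtain ⟨f, hf⟩ := exists_surjective_nat ι
  refine ⟨fun y n => e y (f n), by fun_prop, ?_⟩
  intro x y hxy
  apply hi
  ext i
  obtain ⟨n, rfl⟩ := hf i
  exact congrFun hxy n

theorem continuous_mul_of_bounded {X : Type} [TopologicalSpace X] {u v : X → ℝ}
    (hu : Continuous u) (M : ℝ) (hM : ∀ x, |v x| ≤ M) (hv : ContinuousOn v {x | u x ≠ 0}) :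
    Continuous (fun x => u x * v x) := by
  rw [continuous_iff_continuousAt]
  intro x
  by_cases h : u x = 0
  · have h1 : Filter.Tendsto (fun y => |u y| * M) (𝓝 x) (𝓝 0) := by
      have : Continuous (fun y => |u y| * M) := by fun_prop
      simpa [h] using this.tendsto x
    show Filter.Tendsto _ _ (𝓝 (u x * v x))
    rw [h, zero_mul]
    refine squeeze_zero_norm (fun y => ?_) h1
    rw [Real.norm_eq_abs, abs_mul]
    exact mul_le_mul_of_nonneg_left (hM y) (abs_nonneg _)
  · have ho : IsOpen {x | u x ≠ 0} := isOpen_ne_fun hu continuous_const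
    exact hu.continuousAt.mul (hv.continuousAt (ho.mem_nhds h))

theorem EmbR_join {A B : Type} [TopologicalSpace A] [TopologicalSpace B] [CompactSpace A]
    [CompactSpace B] [Nonempty A] [Nonempty B] (hA : EmbR A) (hB : EmbR B) : EmbR (Join A B) := by
  obtain ⟨e, he, hei⟩ := hA
  obtain ⟨d, hd, hdi⟩ := hB
  have bdd : ∀ {Y : Type} [TopologicalSpace Y] [CompactSpace Y] (f : Y → ℝ), Continuous f →
      ∃ M, ∀ y, |f y| ≤ M := by
    intro Y _ _ f hf
    obtain ⟨M, hM⟩ := (isCompact_range hf.abs).bddAbove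
    exact ⟨M, fun y => hM ⟨y, rfl⟩⟩
  let E : Join A B → Option (ℕ ⊕ ℕ) → ℝ := fun q i => match i with
    | none => (jT q : ℝ)
    | some (Sum.inl n) => (1 - (jT q : ℝ)) * e (jA q) n
    | some (Sum.inr n) => (jT q : ℝ) * d (jB q) n
  have hT : Continuous (fun q : Join A B => (jT q : ℝ)) := continuous_subtype_val.comp continuous_jT
  have hE : Continuous E := by
    rw [continuous_pi_iff]
    rintro (_ | n | n)
    · exact hT
    · obtain ⟨M, hM⟩ := bdd (fun a => e a n) (by fun_prop)
      refine continuous_mul_of_bounded (by fun_prop) M (fun q => hM _) ?_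
      refine ((by fun_prop : Continuous (fun a => e a n)).comp_continuousOn continuousOn_jA).mono ?_
      intro q hq h
      apply hq
      simp [h]
    · obtain ⟨M, hM⟩ := bdd (fun a => d a n) (by fun_prop)
      refine continuous_mul_of_bounded (by fun_prop) M (fun q => hM _) ?_
      refine ((by fun_prop : Continuous (fun a => d a n)).comp_continuousOn continuousOn_jB).mono ?_
      intro q hq h
      apply hq
      simp [h]
  refine EmbR_of_countable E hE ?_
  intro p q hpq
  have h0 : jT p = jT q := Subtype.ext (congrFun hpq none)
  rw [← jmk_eta p, ← jmk_eta q, ← h0]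
  apply jmk_congr
  · intro h1
    apply hei
    ext n
    have := congrFun hpq (some (Sum.inl n))
    simp only [E, ← h0] at this
    refine mul_left_cancel₀ ?_ this
    intro h
    apply h1
    apply Subtype.ext
    show (jT p : ℝ) = 1
    linarith
  · intro h1
    apply hdi
    ext n
    have := congrFun hpq (some (Sum.inr n))
    simp only [E, ← h0] at this
    refine mul_left_cancel₀ ?_ this
    intro h
    exact h1 (Subtype.ext h)

theorem t_ext {X : Type} [TopologicalSpace X] [NormalSpace X] {F C1 C0 : Set X} (hF : IsClosed F)
    (h1 : IsClosed C1) (h0 : IsClosed C0) (hd : Disjoint C1 C0) (t : X → unitInterval)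
    (ht : ContinuousOn t F) (ht1 : ∀ x ∈ F, x ∈ C1 → t x = 1) (ht0 : ∀ x ∈ F, x ∈ C0 → t x = 0) :
    ∃ T : X → unitInterval, Continuous T ∧ EqOn T t F ∧ (∀ x ∈ C1, T x = 1) ∧
      ∀ x ∈ C0, T x = 0 := by
  obtain ⟨k, hk, hk1, hk0⟩ := glue_closed' h1 h0 (fun _ => (1 : unitInterval)) (fun _ => 0)
    continuousOn_const continuousOn_const
    (fun x hx => absurd hx.2 (Set.disjoint_left.1 hd hx.1))
  obtain ⟨l, hl, hl1, hl2⟩ := glue_closed' hF (h1.union h0) t k ht hk (by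
    rintro x ⟨hx, hx1 | hx0⟩
    · rw [ht1 x hx hx1, hk1 hx1]
    · rw [ht0 x hx hx0, hk0 hx0])
  obtain ⟨T, hT, hTl⟩ := tietze_total _ (hF.union (h1.union h0)) l hl
  refine ⟨T, hT, fun x hx => ?_, fun x hx => ?_, fun x hx => ?_⟩
  · rw [hTl (Or.inl hx), hl1 hx]
  · rw [hTl (Or.inr (Or.inl hx)), hl2 (Or.inl hx), hk1 hx]
  · rw [hTl (Or.inr (Or.inr hx)), hl2 (Or.inr hx), hk0 hx]

theorem ME_join {A B : Type} [TopologicalSpace A] [TopologicalSpace B] [CompactSpace A]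
    [CompactSpace B] [Nonempty A] [Nonempty B] (hA : ME A) (hB : ME B) : ME (Join A B) := by
  intro X _ _ F hF f hf
  have htF : ContinuousOn (fun x => jT (f x)) F := continuous_jT.comp_continuousOn hf
  let _ := TopologicalSpace.metrizableSpaceMetric X
  obtain ⟨T, hT, hTt⟩ := tietze_total F hF _ htF
  have o1 : IsOpen {x | T x ≠ 1} := isOpen_compl_singleton.preimage hT
  have o0 : IsOpen {x | T x ≠ 0} := isOpen_compl_singleton.preimage hT
  obtain ⟨VA, hVA, hFA, hVA1, gA, hgA, hgfA⟩ := ME_open hA _ F o1 hF (fun x => jA (f x)) (by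
    refine continuousOn_jA.comp (hf.mono inter_subset_left) ?_
    intro x hx h
    exact hx.2 ((hTt hx.1).trans h))
  obtain ⟨VB, hVB, hFB, hVB1, gB, hgB, hgfB⟩ := ME_open hB _ F o0 hF (fun x => jB (f x)) (by
    refine continuousOn_jB.comp (hf.mono inter_subset_left) ?_
    intro x hx h
    exact hx.2 ((hTt hx.1).trans h))
  have hFV : F ⊆ VA ∪ VB := by
    intro x hx
    by_cases h : T x = 1
    · right
      refine hFB ⟨hx, ?_⟩
      show T x ≠ 0
      rw [h]; exact one_ne_zero
    · exact Or.inl (hFA ⟨hx, h⟩)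
  obtain ⟨V, hV, hFV', hVc⟩ := normal_exists_closure_subset hF (hVA.union hVB) hFV
  obtain ⟨S, hS, hSF, hS1, hS0⟩ := t_ext hF (C1 := closure V ∩ VAᶜ) (C0 := closure V ∩ VBᶜ)
    (isClosed_closure.inter hVA.isClosed_compl) (isClosed_closure.inter hVB.isClosed_compl)
    (by
      rw [Set.disjoint_left]
      rintro x ⟨hx, hxA⟩ ⟨_, hxB⟩
      rcases hVc hx with h | h
      · exact hxA h
      · exact hxB h) (fun x => jT (f x)) htF
    (by
      rintro x hx ⟨_, hxA⟩
      by_contra h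
      exact hxA (hFA ⟨hx, fun h' => h ((hTt hx).symm.trans h')⟩))
    (by
      rintro x hx ⟨_, hxA⟩
      by_contra h
      exact hxA (hFB ⟨hx, fun h' => h ((hTt hx).symm.trans h')⟩))
  refine ⟨V, hV, hFV', fun x => jmk (gA x) (gB x) (S x), ?_, ?_⟩
  · apply continuousOn_jmk hS.continuousOn
    · refine hgA.mono ?_
      rintro x ⟨hx, h⟩
      by_contra hn
      exact h (hS1 x ⟨subset_closure hx, hn⟩)
    · refine hgB.mono ?_
      rintro x ⟨hx, h⟩
      by_contra hn
      exact h (hS0 x ⟨subset_closure hx, hn⟩)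
  · intro x hx
    show jmk (gA x) (gB x) (S x) = f x
    rw [← jmk_eta (f x), hSF hx]
    have hTx : T x = jT (f x) := hTt hx
    apply jmk_congr
    · intro h
      exact hgfA ⟨hx, fun h' => h (hTx.symm.trans h')⟩
    · intro h
      exact hgfB ⟨hx, fun h' => h (hTx.symm.trans h')⟩

theorem joinPow_props (L : Type) [TopologicalSpace L] [CompactSpace L] [Nonempty L]
    (h1 : EmbR L) (h2 : ME L) (n : ℕ) : CompactSpace (JoinPow L n) ∧ Nonempty (JoinPow L n) ∧
      EmbR (JoinPow L n) ∧ ME (JoinPow L n) := by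
  induction n with
  | zero => exact ⟨‹CompactSpace L›, ‹Nonempty L›, h1, h2⟩
  | succ n ih =>
    obtain ⟨i1, i2, i3, i4⟩ := ih
    have c1 : CompactSpace (Join L (JoinPow L n)) := inferInstance
    have c2 : Nonempty (Join L (JoinPow L n)) :=
      ⟨jmk (Classical.arbitrary L) (Classical.arbitrary _) 0⟩
    have c3 : EmbR (Join L (JoinPow L n)) := EmbR_join h1 i3
    have c4 : ME (Join L (JoinPow L n)) := ME_join h2 i4
    exact ⟨c1, c2, c3, c4⟩

theorem LDimLE_iff (L X : Type) [TopologicalSpace L] [TopologicalSpace X] (n : ℕ)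
    [Nonempty (JoinPow L n)] : LDimLE L X n ↔ EP (JoinPow L n) X := by
  constructor
  · intro h F hF f hf
    obtain ⟨g, hg⟩ := h F hF ⟨F.domRestrict f, continuousOn_iff_continuous_domRestrict.1 hf⟩
    exact ⟨g, g.continuous, fun x hx => hg ⟨x, hx⟩⟩
  · intro h F hF f
    obtain ⟨f', hf', hff⟩ := exists_total F f f.continuous
    obtain ⟨g, hg, hgf⟩ := h F hF f' hf'
    exact ⟨⟨g, hg⟩, fun x => (hgf x.2).trans (hff x)⟩

/-- `L-Ind X < α`. -/
def LIndLT (L X : Type) [TopologicalSpace L] [TopologicalSpace X] (α : Ordinal.{0}) : Prop :=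
  IsEmpty X ∨ ∃ β < α, LIndLE L X β

theorem LIndLE_iff (L X : Type) [TopologicalSpace L] [Nonempty L] [TopologicalSpace X]
    (α : Ordinal.{0}) : LIndLE L X α ↔ ∀ F : Set X, IsClosed F → ∀ f : X → L, ContinuousOn f F →
      ∃ U : Set X, IsOpen U ∧ F ⊆ U ∧ ∃ g : X → L, ContinuousOn g U ∧ EqOn g f F ∧
        LIndLT L (↥(Uᶜ)) α := by
  have key : LIndLE L X α ↔ ∀ F : Set X, IsClosed F → ∀ f : C(F, L),
      ∃ U : Set X, IsOpen U ∧ ∃ hFU : F ⊆ U,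
        (∃ g : C(U, L), ∀ (x : X) (hx : x ∈ F), g ⟨x, hFU hx⟩ = f ⟨x, hx⟩) ∧
        (Uᶜ = (∅ : Set X) ∨ ∃ β : Set.Iio α, LIndLE L (↥(Uᶜ)) β.1) := by
    unfold LIndLE
    conv_lhs => unfold LIndLeAux
    rw [WellFounded.fix_eq]
    rfl
  rw [key]
  constructor
  · intro h F hF f hf
    obtain ⟨U, hU, hFU, ⟨g, hg⟩, hP⟩ :=
      h F hF ⟨F.domRestrict f, continuousOn_iff_continuous_domRestrict.1 hf⟩
    obtain ⟨g', hg', hgg⟩ := exists_total U g g.continuous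
    refine ⟨U, hU, hFU, g', hg', fun x hx => (hgg ⟨x, hFU hx⟩).trans (hg x hx), ?_⟩
    rcases hP with hP | ⟨β, hβ⟩
    · left
      rw [hP]
      infer_instance
    · exact Or.inr ⟨β.1, β.2, hβ⟩
  · intro h F hF f
    obtain ⟨f', hf', hff⟩ := exists_total F f f.continuous
    obtain ⟨U, hU, hFU, g, hg, hgf, hP⟩ := h F hF f' hf'
    refine ⟨U, hU, hFU, ⟨⟨U.domRestrict g, continuousOn_iff_continuous_domRestrict.1 hg⟩,
      fun x hx => (hgf hx).trans (hff ⟨x, hx⟩)⟩, ?_⟩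
    rcases hP with hP | ⟨β, hβ, hP⟩
    · left
      exact Set.isEmpty_coe_sort.1 hP
    · exact Or.inr ⟨⟨β, hβ⟩, hP⟩

section basics

variable {L : Type} [TopologicalSpace L] [Nonempty L]

theorem LIndLT.mono {X : Type} [TopologicalSpace X] {α β : Ordinal.{0}} (h : LIndLT L X α)
    (hab : α ≤ β) : LIndLT L X β := by
  rcases h with h | ⟨γ, h1, h2⟩
  · exact Or.inl h
  · exact Or.inr ⟨γ, h1.trans_le hab, h2⟩

theorem LIndLE.mono {X : Type} [TopologicalSpace X] {α β : Ordinal.{0}} (h : LIndLE L X α)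
    (hab : α ≤ β) : LIndLE L X β := by
  rw [LIndLE_iff] at h ⊢
  intro F hF f hf
  obtain ⟨U, hU, hFU, g, hg, hgf, hP⟩ := h F hF f hf
  exact ⟨U, hU, hFU, g, hg, hgf, hP.mono hab⟩

theorem LIndLE_of_isEmpty {X : Type} [TopologicalSpace X] [IsEmpty X] (α : Ordinal.{0}) :
    LIndLE L X α := by
  rw [LIndLE_iff]
  intro F hF f hf
  refine ⟨Set.univ, isOpen_univ, subset_univ _, f, ?_, fun x _ => rfl, Or.inl ?_⟩
  · intro x; exact isEmptyElim x
  · exact ⟨fun x => isEmptyElim x.1⟩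

theorem LIndLT.le {X : Type} [TopologicalSpace X] {α : Ordinal.{0}} (h : LIndLT L X α) :
    LIndLE L X α := by
  rcases h with h | ⟨γ, h1, h2⟩
  · exact LIndLE_of_isEmpty α
  · exact h2.mono h1.le

theorem LIndLE_of_EP {X : Type} [TopologicalSpace X] (h : EP L X) (α : Ordinal.{0}) :
    LIndLE L X α := by
  rw [LIndLE_iff]
  intro F hF f hf
  obtain ⟨g, hg, hgf⟩ := h F hF f hf
  refine ⟨Set.univ, isOpen_univ, subset_univ _, g, hg.continuousOn, hgf, Or.inl ?_⟩
  simp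

theorem exists_push {A X Y : Type} [TopologicalSpace A] [TopologicalSpace X] [TopologicalSpace Y]
    [Nonempty Y] {e : A → X} (he : IsEmbedding e) {F : Set A} {f : A → Y} (hf : ContinuousOn f F) :
    ∃ f' : X → Y, ContinuousOn f' (e '' F) ∧ ∀ a, f' (e a) = f a := by
  rcases isEmpty_or_nonempty A with hA | hA
  · refine ⟨fun _ => Classical.arbitrary Y, continuousOn_const, fun a => isEmptyElim a⟩
  have hl := Function.leftInverse_invFun he.injective
  refine ⟨f ∘ Function.invFun e, ?_, fun a => by simp [hl a]⟩
  refine hf.comp ?_ ?_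
  · rintro _ ⟨a, ha, rfl⟩
    rw [ContinuousWithinAt, hl a, he.tendsto_nhds_iff]
    have : Filter.Tendsto (fun x => x) (𝓝[e '' F] (e a)) (𝓝 (e a)) := Filter.tendsto_id'.2 inf_le_left
    refine this.congr' ?_
    filter_upwards [self_mem_nhdsWithin] with x hx
    obtain ⟨b, _, rfl⟩ := hx
    simp [hl b]
  · rintro _ ⟨a, ha, rfl⟩
    rw [hl a]; exact ha

theorem LIndLE.of_emb {α : Ordinal.{0}} : ∀ {X A : Type} [TopologicalSpace X] [TopologicalSpace A],
    LIndLE L X α → ∀ {e : A → X}, IsClosedEmbedding e → LIndLE L A α := by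
  induction α using WellFoundedLT.induction with
  | ind α ih =>
    intro X A _ _ h e he
    rw [LIndLE_iff] at h ⊢
    intro F hF f hf
    obtain ⟨f', hf', hff⟩ := exists_push he.isEmbedding hf
    obtain ⟨U, hU, hFU, g, hg, hgf, hP⟩ := h (e '' F) (he.isClosedMap F hF) f' hf'
    refine ⟨e ⁻¹' U, hU.preimage he.continuous, fun x hx => hFU ⟨x, hx, rfl⟩, g ∘ e,
      hg.comp he.continuous.continuousOn (fun x hx => hx),
      fun x hx => (hgf ⟨x, hx, rfl⟩).trans (hff x), ?_⟩
    rcases hP with hP | ⟨β, hβ, hP⟩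
    · left
      exact ⟨fun x => hP.false ⟨e x.1, x.2⟩⟩
    · right
      exact ⟨β, hβ, ih β hβ hP (he.restrictPreimage Uᶜ)⟩

theorem closedEmb_codRestrict {A X : Type} [TopologicalSpace X] [TopologicalSpace A]
    {S : Set X} {e : A → X} (he : IsClosedEmbedding e) (hS : ∀ a, e a ∈ S) :
    IsClosedEmbedding (fun a => (⟨e a, hS a⟩ : S)) := by
  have h1 : IsEmbedding (fun a => (⟨e a, hS a⟩ : S)) :=
    IsEmbedding.of_comp (by exact he.continuous.subtype_mk hS) continuous_subtype_val
      (by exact he.isEmbedding)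
  refine ⟨h1, ?_⟩
  have : range (fun a => (⟨e a, hS a⟩ : S)) = Subtype.val ⁻¹' (range e) := by
    ext ⟨x, hx⟩
    simp
  rw [this]
  exact he.isClosed_range.preimage continuous_subtype_val

theorem LIndLE.of_sub {α : Ordinal.{0}} {X A : Type} [TopologicalSpace X] [TopologicalSpace A]
    {S : Set X} (h : LIndLE L S α) {e : A → X} (he : IsClosedEmbedding e) (hS : ∀ a, e a ∈ S) :
    LIndLE L A α := h.of_emb (closedEmb_codRestrict he hS)

theorem LIndLT.of_sub {α : Ordinal.{0}} {X A : Type} [TopologicalSpace X] [TopologicalSpace A]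
    {S : Set X} (h : LIndLT L S α) {e : A → X} (he : IsClosedEmbedding e) (hS : ∀ a, e a ∈ S) :
    LIndLT L A α := by
  rcases h with h | ⟨γ, h1, h2⟩
  · exact Or.inl ⟨fun a => h.false ⟨e a, hS a⟩⟩
  · exact Or.inr ⟨γ, h1, h2.of_sub he hS⟩

theorem LIndLE.subset {α : Ordinal.{0}} {X : Type} [TopologicalSpace X]
    {S T : Set X} (h : LIndLE L S α) (hT : IsClosed T) (hTS : T ⊆ S) : LIndLE L T α :=
  h.of_sub hT.isClosedEmbedding_subtypeVal (fun a => hTS a.2)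

theorem LIndLT.subset {α : Ordinal.{0}} {X : Type} [TopologicalSpace X]
    {S T : Set X} (h : LIndLT L S α) (hT : IsClosed T) (hTS : T ⊆ S) : LIndLT L T α :=
  h.of_sub hT.isClosedEmbedding_subtypeVal (fun a => hTS a.2)

/-- the push-forward of a partition along a closed embedding -/
theorem LIndLE.push {α : Ordinal.{0}} {A X : Type} [TopologicalSpace A] [TopologicalSpace X]
    (h : LIndLE L A α) {e : A → X} (he : IsClosedEmbedding e) {F : Set X} (hF : IsClosed F)
    (f : X → L) (hf : ContinuousOn f (F ∩ range e)) :
    ∃ U : Set X, IsOpen U ∧ F ∩ range e ⊆ U ∧ ∃ g : X → L, ContinuousOn g (U ∩ range e) ∧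
      EqOn g f (F ∩ range e) ∧ LIndLT L (↥(range e \ U)) α := by
  rw [LIndLE_iff] at h
  obtain ⟨U, hU, hFU, g, hg, hgf, hP⟩ := h (e ⁻¹' F) (hF.preimage he.continuous) (f ∘ e)
    (hf.comp he.continuous.continuousOn (fun x hx => ⟨hx, x, rfl⟩))
  obtain ⟨V, hV, rfl⟩ := he.isInducing.isOpen_iff.1 hU
  obtain ⟨g', hg', hgg⟩ := exists_push he.isEmbedding hg
  refine ⟨V, hV, ?_, g', ?_, ?_, ?_⟩
  · rintro _ ⟨hx, a, rfl⟩
    exact hFU hx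
  · rwa [image_preimage_eq_inter_range] at hg'
  · rintro _ ⟨hx, a, rfl⟩
    rw [hgg]
    exact hgf hx
  · have hE : ∃ e' : ↥(range e \ V) → A, IsClosedEmbedding e' ∧ ∀ x, e' x ∈ (e ⁻¹' V)ᶜ := by
      have hc : IsClosed (range e \ V) := he.isClosed_range.sdiff hV
      have hk : ∀ x : ↥(range e \ V), ∃ a, e a = x.1 := fun x => x.2.1
      choose k hk using hk
      refine ⟨k, ?_, fun x hx => x.2.2 ?_⟩
      · have hcomp : e ∘ k = Subtype.val := funext hk
        have hkc : Continuous k := by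
          rw [he.isInducing.continuous_iff, hcomp]
          exact continuous_subtype_val
        refine ⟨IsEmbedding.of_comp hkc he.continuous ?_, ?_⟩
        · rw [hcomp]; exact IsEmbedding.subtypeVal
        · rw [he.isClosed_iff_image_isClosed, ← range_comp, hcomp, Subtype.range_coe]
          exact hc
      · rw [← hk x]; exact hx
    obtain ⟨e', h1, h2⟩ := hE
    exact hP.of_sub h1 h2

theorem LIndLE.push_set {α : Ordinal.{0}} {X : Type} [TopologicalSpace X] {S : Set X}
    (h : LIndLE L S α) (hS : IsClosed S) {F : Set X} (hF : IsClosed F)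
    (f : X → L) (hf : ContinuousOn f (F ∩ S)) :
    ∃ U : Set X, IsOpen U ∧ F ∩ S ⊆ U ∧ ∃ g : X → L, ContinuousOn g (U ∩ S) ∧
      EqOn g f (F ∩ S) ∧ LIndLT L (↥(S \ U)) α := by
  have := h.push hS.isClosedEmbedding_subtypeVal hF f (by rwa [Subtype.range_coe])
  rwa [Subtype.range_coe] at this

/-- Finite clopen sums. -/
theorem LIndLE_sum {J : Type} [Finite J] [TopologicalSpace J] [DiscreteTopology J]
    {γ : Ordinal.{0}} : ∀ {X : Type} [TopologicalSpace X] {κ : X → J}, Continuous κ →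
      (∀ j, LIndLE L (↥(κ ⁻¹' {j})) γ) → LIndLE L X γ := by
  induction γ using WellFoundedLT.induction with
  | ind γ ih =>
    intro X _ κ hκ h
    rw [LIndLE_iff]
    intro F hF f hf
    have hcl : ∀ j, IsClosed (κ ⁻¹' {j}) := fun j => (isClosed_discrete _).preimage hκ
    have hop : ∀ j, IsOpen (κ ⁻¹' {j}) := fun j => (isOpen_discrete _).preimage hκ
    have h' := fun j => (h j).push_set (hcl j) hF f (hf.mono inter_subset_left)
    choose U hU hFU g hg hgf hP using h'
    have hUeq : {x | x ∈ U (κ x)} = ⋃ j, (κ ⁻¹' {j} ∩ U j) := by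
      ext x; simp
    have hUo : IsOpen {x | x ∈ U (κ x)} := by
      rw [hUeq]
      exact isOpen_iUnion (fun j => (hop j).inter (hU j))
    have hPj : ∀ j, LIndLT L (↥((fun x : ↥({x | x ∈ U (κ x)}ᶜ) => κ x) ⁻¹' {j})) γ := by
      intro j
      refine (hP j).of_sub (e := fun x => x.1.1) ?_ ?_
      · refine hUo.isClosed_compl.isClosedEmbedding_subtypeVal.comp ?_
        refine IsClosed.isClosedEmbedding_subtypeVal ?_
        exact (isClosed_discrete _).preimage (hκ.comp continuous_subtype_val)
      · rintro ⟨⟨x, hx⟩, hxj⟩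
        have : κ x = j := hxj
        refine ⟨this, fun hh => hx ?_⟩
        show x ∈ U (κ x)
        rw [this]; exact hh
    refine ⟨_, hUo, fun x hx => hFU (κ x) ⟨hx, rfl⟩, fun x => g (κ x) x, ?_, ?_, ?_⟩
    · intro x hx
      have hc : ContinuousAt (g (κ x)) x :=
        ((hg (κ x)).continuousAt (((hU (κ x)).inter (hop (κ x))).mem_nhds ⟨hx, rfl⟩))
      refine ContinuousAt.continuousWithinAt ?_
      refine hc.congr ?_
      filter_upwards [(hop (κ x)).mem_nhds rfl] with y hy
      have : κ y = κ x := hy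
      rw [this]
    · intro x hx
      exact hgf (κ x) ⟨hx, rfl⟩
    · rcases isEmpty_or_nonempty (↥({x | x ∈ U (κ x)}ᶜ)) with he | hne
      · exact Or.inl he
      · right
        have hex : ∀ j, ∃ β < γ, LIndLE L (↥((fun x : ↥({x | x ∈ U (κ x)}ᶜ) => κ x) ⁻¹' {j})) β := by
          have hγ : ∃ β, β < γ := by
            rcases hPj (κ hne.some) with hh | ⟨β, hβ, _⟩
            · exact (hh.false ⟨hne.some, rfl⟩).elim
            · exact ⟨β, hβ⟩
          intro j
          rcases hPj j with hh | hh
          · obtain ⟨β, hβ⟩ := hγ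
            exact ⟨β, hβ, LIndLE_of_isEmpty β⟩
          · exact hh
        choose b hb hbP using hex
        have : Nonempty J := ⟨κ hne.some⟩
        obtain ⟨j0, hj0⟩ := Finite.exists_max b
        refine ⟨b j0, hb j0, ih (b j0) (hb j0) (hκ.comp continuous_subtype_val) ?_⟩
        intro j
        exact (hbP j).mono (hj0 j)

end basics

theorem LInd_eq (L X : Type) [TopologicalSpace L] [TopologicalSpace X] [Nonempty X]
    {α : Ordinal.{0}} (h1 : LIndLE L X α) (h2 : ∀ β < α, ¬ LIndLE L X β) :
    LInd L X = Dim.ofOrdinal α := by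
  unfold LInd
  rw [if_neg (not_isEmpty_of_nonempty X), if_pos ⟨α, h1⟩]
  congr 1
  apply le_antisymm
  · exact csInf_le' h1
  · refine le_csInf ⟨α, h1⟩ ?_
    intro β hβ
    by_contra hlt
    exact h2 β (not_le.1 hlt) hβ

theorem ofOrdinal_inj {a b : Ordinal.{0}} (h : Dim.ofOrdinal a = Dim.ofOrdinal b) : a = b := by
  unfold Dim.ofOrdinal at h
  exact WithBot.coe_injective (WithTop.coe_injective h)

theorem LDim_spec (L X : Type) [TopologicalSpace L] [TopologicalSpace X] [Nonempty X] {n : ℕ}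
    (h : LDim L X = Dim.ofOrdinal ((n : ℕ) : Ordinal.{0})) :
    LDimLE L X n ∧ ∀ k < n, ¬ LDimLE L X k := by
  unfold LDim at h
  rw [if_neg (not_isEmpty_of_nonempty X)] at h
  by_cases he : ∃ n, LDimLE L X n
  · rw [if_pos he] at h
    have h2 : sInf {n | LDimLE L X n} = n := by exact_mod_cast ofOrdinal_inj h
    have h3 : LDimLE L X (sInf {n | LDimLE L X n}) := Nat.sInf_mem he
    rw [h2] at h3
    refine ⟨h3, fun k hk hk' => ?_⟩
    have : sInf {n | LDimLE L X n} ≤ k := Nat.sInf_le hk'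
    omega
  · rw [if_neg he] at h
    exact absurd h (by simp [Dim.ofOrdinal])

theorem LDim_congr (L X Y : Type) [TopologicalSpace L] [TopologicalSpace X] [TopologicalSpace Y]
    [Nonempty X] [Nonempty Y] (h : ∀ n, LDimLE L X n ↔ LDimLE L Y n) : LDim L X = LDim L Y := by
  unfold LDim
  simp only [h, if_neg (not_isEmpty_of_nonempty X), if_neg (not_isEmpty_of_nonempty Y)]

theorem EP.push {K X : Type} [TopologicalSpace K] [Nonempty K] [TopologicalSpace X] {P : Set X}
    (h : EP K P) {F : Set X} (hF : IsClosed F) (f : X → K)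
    (hf : ContinuousOn f (F ∩ P)) : ∃ g : X → K, ContinuousOn g P ∧ EqOn g f (F ∩ P) := by
  obtain ⟨g, hg, hgf⟩ := h (Subtype.val ⁻¹' F) (hF.preimage continuous_subtype_val)
    (f ∘ Subtype.val) (hf.comp continuous_subtype_val.continuousOn (fun x hx => ⟨hx, x.2⟩))
  obtain ⟨g', hg', hgg⟩ := exists_total P g hg
  exact ⟨g', hg', fun x hx => (hgg ⟨x, hx.2⟩).trans (hgf (x := ⟨x, hx.2⟩) hx.1)⟩

theorem EP.of_emb {K X A : Type} [TopologicalSpace K] [Nonempty K] [TopologicalSpace X]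
    [TopologicalSpace A] (h : EP K X) {e : A → X} (he : IsClosedEmbedding e) : EP K A := by
  intro F hF f hf
  obtain ⟨f', hf', hff⟩ := exists_push he.isEmbedding hf
  obtain ⟨g, hg, hgf⟩ := h (e '' F) (he.isClosedMap F hF) f' hf'
  exact ⟨g ∘ e, hg.comp he.continuous, fun x hx => (hgf ⟨x, hx, rfl⟩).trans (hff x)⟩

def pI (s : ℝ) : unitInterval := Set.projIcc 0 1 zero_le_one s

theorem continuous_pI : Continuous pI := continuous_projIcc (h := zero_le_one)

theorem pI_one {s : ℝ} (h : 1 ≤ s) : pI s = 1 := Set.projIcc_of_right_le _ h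
theorem pI_zero {s : ℝ} (h : s ≤ 0) : pI s = 0 := Set.projIcc_of_le_left _ h
theorem pI_coe (t : unitInterval) : pI (t : ℝ) = t := Set.projIcc_val _ t

theorem EP_join {L K X : Type} [TopologicalSpace L] [TopologicalSpace K] [TopologicalSpace X]
    [CompactSpace L] [CompactSpace K] [Nonempty L] [Nonempty K] [CompactSpace X] [T2Space X]
    (hK : NE K) (hJ : NE (Join L K))
    (hX : ∀ F : Set X, IsClosed F → ∀ f : X → L, ContinuousOn f F →
      ∃ U : Set X, IsOpen U ∧ F ⊆ U ∧ ∃ g : X → L, ContinuousOn g U ∧ EqOn g f F ∧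
        EP K (↥(Uᶜ))) : EP (Join L K) X := by
  intro F hF f hf
  have hT : ContinuousOn (fun x => ((jT (f x) : unitInterval) : ℝ)) F :=
    (continuous_subtype_val.comp continuous_jT).comp_continuousOn hf
  have hA0 : IsClosed (F ∩ (fun x => ((jT (f x) : unitInterval) : ℝ)) ⁻¹' Iic (2/3)) :=
    hT.preimage_isClosed_of_isClosed hF isClosed_Iic
  have hB0 : IsClosed (F ∩ (fun x => ((jT (f x) : unitInterval) : ℝ)) ⁻¹' Ici (1/3)) :=
    hT.preimage_isClosed_of_isClosed hF isClosed_Ici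
  set A0 := F ∩ (fun x => ((jT (f x) : unitInterval) : ℝ)) ⁻¹' Iic (2/3) with hA0d
  set B0 := F ∩ (fun x => ((jT (f x) : unitInterval) : ℝ)) ⁻¹' Ici (1/3) with hB0d
  have hjA : ContinuousOn (fun x => jA (f x)) A0 := by
    refine continuousOn_jA.comp (hf.mono inter_subset_left) ?_
    intro x hx h
    have : ((jT (f x) : unitInterval) : ℝ) ≤ 2/3 := hx.2
    rw [h] at this
    norm_num at this
  have hjB : ContinuousOn (fun x => jB (f x)) B0 := by
    refine continuousOn_jB.comp (hf.mono inter_subset_left) ?_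
    intro x hx h
    have : 1/3 ≤ ((jT (f x) : unitInterval) : ℝ) := hx.2
    rw [h] at this
    norm_num at this
  obtain ⟨UL, hUL, hAU, gL, hgL, hgLf, hP⟩ := hX A0 hA0 _ hjA
  obtain ⟨gP, hgP, hgPf⟩ := hP.push hB0 _ (hjB.mono inter_subset_left)
  obtain ⟨k, hk, hkB, hkP⟩ := glue_closed' hB0 hUL.isClosed_compl _ gP hjB hgP hgPf.symm
  obtain ⟨UK, hUK, hBU, gK, hgK, hgKk⟩ := hK X _ (hB0.union hUL.isClosed_compl) k hk
  obtain ⟨T, hTc, hTF, hT1, hT0⟩ := t_ext hF (C1 := ULᶜ) (C0 := UKᶜ) hUL.isClosed_compl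
    hUK.isClosed_compl (Set.disjoint_left.2 fun x hx hx' => hx' (hBU (Or.inr hx)))
    (fun x => pI (3 * ((jT (f x) : unitInterval) : ℝ) - 1))
    (continuous_pI.comp_continuousOn ((continuousOn_const.mul hT).sub continuousOn_const))
    (by
      intro x hx hx1
      apply pI_one
      have : ¬ ((jT (f x) : unitInterval) : ℝ) ≤ 2/3 := fun h => hx1 (hAU ⟨hx, h⟩)
      linarith)
    (by
      intro x hx hx1
      apply pI_zero
      have : ¬ 1/3 ≤ ((jT (f x) : unitInterval) : ℝ) := fun h => hx1 (hBU (Or.inl ⟨hx, h⟩))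
      linarith)
  obtain ⟨g, hg, hgF⟩ := homotopy_ext hJ F hF
    (fun p => jmk (jA (f p.1)) (jB (f p.1))
      (pI ((1 - (p.2 : ℝ)) * (3 * ((jT (f p.1) : unitInterval) : ℝ) - 1)
        + p.2 * ((jT (f p.1) : unitInterval) : ℝ))))
    (by
      have hTp : ContinuousOn (fun p : X × unitInterval => ((jT (f p.1) : unitInterval) : ℝ))
        (F ×ˢ Set.univ) := hT.comp continuous_fst.continuousOn (fun p hp => hp.1)
      have hfp : ContinuousOn (fun p : X × unitInterval => f p.1)
        (F ×ˢ Set.univ) := hf.comp continuous_fst.continuousOn (fun p hp => hp.1)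
      have hs : ContinuousOn (fun p : X × unitInterval => (p.2 : ℝ)) (F ×ˢ Set.univ) := by fun_prop
      apply continuousOn_jmk
      · refine continuous_pI.comp_continuousOn ?_
        exact ((continuousOn_const.sub hs).mul ((continuousOn_const.mul hTp).sub
          continuousOn_const)).add (hs.mul hTp)
      · refine continuousOn_jA.comp (hfp.mono inter_subset_left) ?_
        rintro p ⟨_, hp⟩ h
        apply hp
        apply pI_one
        rw [h]
        have := p.2.2.2
        norm_num
        linarith
      · refine continuousOn_jB.comp (hfp.mono inter_subset_left) ?_
        rintro p ⟨_, hp⟩ h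
        apply hp
        apply pI_zero
        rw [h]
        have := p.2.2.2
        norm_num
        linarith)
    (fun x => jmk (gL x) (gK x) (T x))
    (by
      rw [← continuousOn_univ]
      apply continuousOn_jmk hTc.continuousOn
      · refine hgL.mono ?_
        rintro x ⟨_, h⟩
        by_contra hn
        exact h (hT1 x hn)
      · refine hgK.mono ?_
        rintro x ⟨_, h⟩
        by_contra hn
        exact h (hT0 x hn))
    (by
      intro x hx
      have e : T x = pI (3 * ((jT (f x) : unitInterval) : ℝ) - 1) := hTF hx
      simp only [e, Set.Icc.coe_zero, sub_zero, one_mul, zero_mul, add_zero]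
      apply jmk_congr
      · intro h
        refine (hgLf ⟨hx, ?_⟩).symm
        by_contra hn
        have hn' : ¬ ((jT (f x) : unitInterval) : ℝ) ≤ 2/3 := hn
        exact h (pI_one (by linarith))
      · intro h
        have hB : x ∈ B0 := by
          refine ⟨hx, ?_⟩
          by_contra hn
          have hn' : ¬ 1/3 ≤ ((jT (f x) : unitInterval) : ℝ) := hn
          exact h (pI_zero (by linarith))
        rw [hgKk (Or.inl hB), hkB hB])
  refine ⟨g, hg, fun x hx => ?_⟩
  rw [hgF x hx]
  simp only [Set.Icc.coe_one, sub_self, zero_mul, one_mul, zero_add, pI_coe]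
  exact jmk_eta _

/-- Bundle of properties of `L`. -/
theorem joinPow_NE (L : Type) [TopologicalSpace L] [CompactSpace L] [Nonempty L]
    (h1 : EmbR L) (h2 : ME L) (n : ℕ) : NE (JoinPow L n) := by
  obtain ⟨i1, i2, i3, i4⟩ := joinPow_props L h1 h2 n
  exact NE_of_ME i3 i4

theorem EP_of_LIndLE {L : Type} [TopologicalSpace L] [CompactSpace L] [Nonempty L]
    (h1 : EmbR L) (h2 : ME L) (k : ℕ) : ∀ {X : Type} [TopologicalSpace X] [CompactSpace X]
    [T2Space X], LIndLE L X (k : Ordinal.{0}) → EP (JoinPow L k) X := by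
  induction k with
  | zero =>
    intro X _ _ _ h
    rw [LIndLE_iff] at h
    intro F hF f hf
    obtain ⟨U, hU, hFU, g, hg, hgf, hP⟩ := h F hF f hf
    have hU' : U = Set.univ := by
      rcases hP with hP | ⟨β, hβ, _⟩
      · exact compl_empty_iff.1 (Set.isEmpty_coe_sort.1 hP)
      · simp at hβ
    rw [hU', continuousOn_univ] at hg
    exact ⟨g, hg, hgf⟩
  | succ k ih =>
    intro X _ _ _ h
    obtain ⟨i1, i2, i3, i4⟩ := joinPow_props L h1 h2 k
    have hJ : NE (Join L (JoinPow L k)) := joinPow_NE L h1 h2 (k + 1)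
    have : EP (Join L (JoinPow L k)) X := by
      refine EP_join (NE_of_ME i3 i4) hJ ?_
      intro F hF f hf
      rw [LIndLE_iff] at h
      obtain ⟨U, hU, hFU, g, hg, hgf, hP⟩ := h F hF f hf
      refine ⟨U, hU, hFU, g, hg, hgf, ?_⟩
      have : CompactSpace ↥Uᶜ := isCompact_iff_compactSpace.1 hU.isClosed_compl.isCompact
      apply ih
      rcases hP with hP | ⟨β, hβ, hP⟩
      · exact LIndLE_of_isEmpty _
      · refine hP.mono ?_
        rw [Nat.cast_succ] at hβ
        exact Order.lt_succ_iff.1 (by simpa using hβ)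
    exact this

theorem sep_step {L K X : Type} [TopologicalSpace L] [TopologicalSpace K] [TopologicalSpace X]
    [CompactSpace L] [CompactSpace K] [Nonempty L] [Nonempty K] [NormalSpace X]
    (hL : NE L) (hK : NE K) (hX : EP (Join L K) X) {F A : Set X} (hF : IsClosed F)
    (hA : IsClosed A) (f : X → L) (hf : ContinuousOn f F) (h : X → K) (hh : ContinuousOn h A) :
    ∃ W : Set X, IsOpen W ∧ F ⊆ W ∧ ∃ f' : X → L, ContinuousOn f' (closure W) ∧ EqOn f' f F ∧
      ∃ h' : X → K, ContinuousOn h' Wᶜ ∧ EqOn h' h (A ∩ Wᶜ) := by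
  obtain ⟨VL, hVL, hFV, f1, hf1, hf1f⟩ := hL X F hF f hf
  obtain ⟨VK, hVK, hAV, h1, hh1, hh1h⟩ := hK X A hA h hh
  obtain ⟨uL, hL0, hL1, hL2⟩ := exists_continuous_zero_one_of_isClosed hVL.isClosed_compl hF
    (Set.disjoint_left.2 fun x hx hx' => hx (hFV hx'))
  obtain ⟨uK, hK0, hK1, hK2⟩ := exists_continuous_zero_one_of_isClosed hVK.isClosed_compl hA
    (Set.disjoint_left.2 fun x hx hx' => hx (hAV hx'))
  let t : X → unitInterval := fun x => pI ((1 + uK x - uL x) / 2)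
  have ht : Continuous t := continuous_pI.comp (by fun_prop)
  have pI_ne1 : ∀ s : ℝ, s < 1 → pI s ≠ 1 := by
    intro s hs h
    have := congrArg Subtype.val h
    simp only [pI, Set.coe_projIcc] at this
    have h2 : max 0 (min 1 s) < 1 := max_lt one_pos (min_lt_of_right_lt hs)
    exact h2.ne this
  have pI_ne0 : ∀ s : ℝ, 0 < s → pI s ≠ 0 := by
    intro s hs h
    have := congrArg Subtype.val h
    simp only [pI, Set.coe_projIcc] at this
    have h2 : 0 < max 0 (min 1 s) := lt_max_of_lt_right (lt_min one_pos hs)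
    exact h2.ne' this
  have tF : ∀ x ∈ F, t x ≠ 1 := by
    intro x hx
    apply pI_ne1
    have e1 : uL x = 1 := hL1 hx
    have := (hK2 x).2
    linarith
  have tA : ∀ x ∈ A, t x ≠ 0 := by
    intro x hx
    apply pI_ne0
    have e1 : uK x = 1 := hK1 hx
    have := (hL2 x).2
    linarith
  have hE : ContinuousOn (fun x => jmk (f1 x) (h1 x) (t x)) (F ∪ A) := by
    apply continuousOn_jmk ht.continuousOn
    · refine hf1.mono ?_
      rintro x ⟨hx, hxt⟩
      by_contra hn
      have e0 : uL x = 0 := hL0 hn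
      have hxA : x ∈ A := hx.resolve_left (fun hxF => hn (hFV hxF))
      have e1 : uK x = 1 := hK1 hxA
      exact hxt (pI_one (by rw [e0, e1]; norm_num))
    · refine hh1.mono ?_
      rintro x ⟨hx, hxt⟩
      by_contra hn
      have e0 : uK x = 0 := hK0 hn
      have hxF : x ∈ F := hx.resolve_right (fun hxA => hn (hAV hxA))
      have e1 : uL x = 1 := hL1 hxF
      exact hxt (pI_zero (by rw [e0, e1]; norm_num))
  obtain ⟨G, hG, hGE⟩ := hX _ (hF.union hA) _ hE
  have hU : IsOpen {x | jT (G x) ≠ 1} :=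
    isOpen_compl_singleton.preimage (continuous_jT.comp hG)
  have hV : IsOpen {x | jT (G x) ≠ 0} :=
    isOpen_compl_singleton.preimage (continuous_jT.comp hG)
  have hjF : ∀ x ∈ F, jT (G x) ≠ 1 := by
    intro x hx
    rw [hGE (Or.inl hx)]
    exact tF x hx
  have hjA : ∀ x ∈ A, jT (G x) ≠ 0 := by
    intro x hx
    rw [hGE (Or.inr hx)]
    exact tA x hx
  obtain ⟨W, hW, hFW, hWU⟩ := normal_exists_closure_subset (hF.union hV.isClosed_compl) hU (by
    rintro x (hx | hx)
    · exact hjF x hx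
    · have : jT (G x) = 0 := by
        by_contra hn
        exact hx hn
      show jT (G x) ≠ 1
      rw [this]
      exact zero_ne_one)
  refine ⟨W, hW, fun x hx => hFW (Or.inl hx), fun x => jA (G x), ?_, ?_, fun x => jB (G x), ?_, ?_⟩
  · exact continuousOn_jA.comp hG.continuousOn hWU
  · intro x hx
    show jA (G x) = f x
    rw [hGE (Or.inl hx)]
    simp only
    rw [jA_jmk _ _ _ (tF x hx), hf1f hx]
  · refine continuousOn_jB.comp hG.continuousOn ?_
    intro x hx h0
    exact hx (hFW (Or.inr (fun hn => hn h0)))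
  · intro x hx
    show jB (G x) = h x
    rw [hGE (Or.inr hx.1)]
    simp only
    rw [jB_jmk _ _ _ (tA x hx.1), hh1h hx.1]

theorem countable_test {K X : Type} [TopologicalSpace K] [CompactSpace K] [Nonempty K]
    (hE : EmbR K) (hK : NE K) [MetricSpace X] [CompactSpace X] :
    ∃ (A : ℕ → Set X) (h : ℕ → X → K), (∀ i, IsClosed (A i)) ∧ (∀ i, ContinuousOn (h i) (A i)) ∧
      ∀ P : Set X, IsClosed P → (∀ i, ∃ h' : X → K, ContinuousOn h' P ∧ EqOn h' (h i) (A i ∩ P)) →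
        EP K P := by
  have hmet : TopologicalSpace.MetrizableSpace K := by
    obtain ⟨e, he, hi⟩ := hE
    exact (he.isClosedEmbedding hi).isEmbedding.metrizableSpace
  let _ : MetricSpace K := TopologicalSpace.metrizableSpaceMetric K
  obtain ⟨ε, hε, hclose⟩ := close_ext hK
  let B := TopologicalSpace.countableBasis X
  have hB : TopologicalSpace.IsTopologicalBasis B := TopologicalSpace.isBasis_countableBasis X
  let I := {s : Set (Set X) // s.Finite ∧ s ⊆ B}
  have hI : Countable I :=
    (Set.countable_ofPred_finite_subset (TopologicalSpace.countable_countableBasis X)).to_subtype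
  have : Nonempty I := ⟨⟨∅, finite_empty, empty_subset _⟩⟩
  let cl : I → Set X := fun s => closure (⋃₀ s.1)
  have hcl : ∀ s, IsClosed (cl s) := fun s => isClosed_closure
  have hcc : ∀ s, CompactSpace (cl s) := fun s => isCompact_iff_compactSpace.1 (hcl s).isCompact
  have hne : ∀ s, Nonempty C(cl s, K) := fun s => ⟨ContinuousMap.const _ (Classical.arbitrary K)⟩
  let d : ∀ s, ℕ → C(cl s, K) := fun s => TopologicalSpace.denseSeq C(cl s, K)
  have hd : ∀ s, DenseRange (d s) := fun s => TopologicalSpace.denseRange_denseSeq _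
  have hD : ∀ s j, ∃ g : X → K, ContinuousOn g (cl s) ∧ ∀ x : cl s, g x = d s j x :=
    fun s j => exists_total (cl s) (d s j) (d s j).continuous
  choose D hDc hDd using hD
  obtain ⟨φ, hφ⟩ := exists_surjective_nat (I × ℕ)
  refine ⟨fun i => cl (φ i).1, fun i => D (φ i).1 (φ i).2, fun i => hcl _, fun i => hDc _ _, ?_⟩
  intro P hP hext F hF f hf
  have he : IsClosedEmbedding (Subtype.val : P → X) := hP.isClosedEmbedding_subtypeVal
  have : CompactSpace P := isCompact_iff_compactSpace.1 hP.isCompact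
  obtain ⟨f1, hf1, hf1f⟩ := exists_push he.isEmbedding hf
  have hF1 : IsClosed (Subtype.val '' F : Set X) := he.isClosedMap F hF
  obtain ⟨U, hU, hFU, f2, hf2, hf2f⟩ := hK X _ hF1 f1 hf1
  obtain ⟨W, hW, hFW, hWU⟩ := normal_exists_closure_subset hF1 hU hFU
  have hc : ∀ x : X, ∃ b : Set X, x ∈ (Subtype.val '' F : Set X) → b ∈ B ∧ x ∈ b ∧ b ⊆ W := by
    intro x
    by_cases hx : x ∈ (Subtype.val '' F : Set X)
    · obtain ⟨b, hb, hxb, hbW⟩ := hB.exists_subset_of_mem_open (hFW hx) hW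
      exact ⟨b, fun _ => ⟨hb, hxb, hbW⟩⟩
    · exact ⟨∅, fun h => absurd h hx⟩
  choose b hb using hc
  obtain ⟨t, htF, ht⟩ := hF1.isCompact.elim_nhds_subcover b
    (fun x hx => (hB.isOpen (hb x hx).1).mem_nhds (hb x hx).2.1)
  let s : I := ⟨b '' (t : Set X), t.finite_toSet.image b, by
    rintro _ ⟨x, hx, rfl⟩
    exact (hb x (htF x hx)).1⟩
  have hFs : (Subtype.val '' F : Set X) ⊆ cl s := by
    refine ht.trans (Subset.trans ?_ subset_closure)
    intro x hx
    simp only [mem_iUnion] at hx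
    obtain ⟨y, hy, hxy⟩ := hx
    exact ⟨b y, ⟨y, hy, rfl⟩, hxy⟩
  have hsU : cl s ⊆ U := by
    refine Subset.trans (closure_mono ?_) hWU
    rintro x ⟨_, ⟨y, hy, rfl⟩, hxy⟩
    exact (hb y (htF y hy)).2.2 hxy
  let q : C(cl s, K) := ⟨(cl s).domRestrict f2,
    continuousOn_iff_continuous_domRestrict.1 (hf2.mono hsU)⟩
  obtain ⟨j, hj⟩ := (hd s).exists_dist_lt q hε
  obtain ⟨i, hi⟩ := hφ (s, j)
  obtain ⟨h', hh', hh'e⟩ := hext i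
  simp only [hi] at hh'e
  refine hclose P F hF f (fun x => h' x.1)
    hf (continuousOn_iff_continuous_domRestrict.1 hh') ?_
  intro x hx
  have hxs : x.1 ∈ cl s := hFs ⟨x, hx, rfl⟩
  have e1 : h' x.1 = d s j ⟨x.1, hxs⟩ := (hh'e ⟨hxs, x.2⟩).trans (hDd s j ⟨x.1, hxs⟩)
  have e2 : f x = q ⟨x.1, hxs⟩ := by
    rw [← hf1f x, ← hf2f ⟨x, hx, rfl⟩]
    rfl
  rw [e1, e2]
  exact (ContinuousMap.dist_apply_le_dist _).trans_lt hj

theorem partition_metric {L K X : Type} [TopologicalSpace L] [TopologicalSpace K]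
    [CompactSpace L] [CompactSpace K] [Nonempty L] [Nonempty K] [MetricSpace X] [CompactSpace X]
    (hL : NE L) (hK : NE K) (hE : EmbR K) (hX : EP (Join L K) X) {F : Set X} (hF : IsClosed F)
    (f : X → L) (hf : ContinuousOn f F) :
    ∃ U : Set X, IsOpen U ∧ F ⊆ U ∧ ∃ g : X → L, ContinuousOn g U ∧ EqOn g f F ∧
        EP K (↥(Uᶜ)) := by
  obtain ⟨A, h, hA, hh, htest⟩ := countable_test (X := X) hE hK
  let S := {p : Set X × (X → L) // IsOpen p.1 ∧ ContinuousOn p.2 (closure p.1)}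
  have step : ∀ (i : ℕ) (p : S), ∃ q : S, closure p.1.1 ⊆ q.1.1 ∧ EqOn q.1.2 p.1.2 (closure p.1.1) ∧
      ∃ h' : X → K, ContinuousOn h' (q.1.1)ᶜ ∧ EqOn h' (h i) (A i ∩ (q.1.1)ᶜ) := by
    intro i p
    obtain ⟨W, hW, hFW, f', hf', hff, h', h1, h2⟩ := sep_step hL hK hX
      (isClosed_closure (s := p.1.1)) (hA i) p.1.2 p.2.2 (h i) (hh i)
    exact ⟨⟨(W, f'), hW, hf'⟩, hFW, hff, h', h1, h2⟩
  choose nx hn1 hn2 hn3 using step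
  obtain ⟨W0, hW0, hFW0, f0, hf0, hff0, _⟩ := sep_step hL hK hX hF (isClosed_empty (X := X)) f hf
    (fun _ => Classical.arbitrary K) continuousOn_const
  let p0 : S := ⟨(W0, f0), hW0, hf0⟩
  let p : ℕ → S := fun n => Nat.rec p0 (fun i q => nx i q) n
  have hp0 : p 0 = p0 := rfl
  have hps : ∀ i, p (i + 1) = nx i (p i) := fun i => rfl
  have hmono : ∀ i j, i ≤ j → closure (p i).1.1 ⊆ closure (p j).1.1 ∧
      EqOn (p j).1.2 (p i).1.2 (closure (p i).1.1) := by
    intro i j hij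
    induction j, hij using Nat.le_induction with
    | base => exact ⟨Subset.rfl, fun x _ => rfl⟩
    | succ j hj ih =>
      rw [hps]
      refine ⟨ih.1.trans ((hn1 j (p j)).trans subset_closure), fun x hx => ?_⟩
      rw [hn2 j (p j) (ih.1 hx), ih.2 hx]
  let U : Set X := ⋃ i, (p i).1.1
  have hU : IsOpen U := isOpen_iUnion (fun i => (p i).2.1)
  let g : X → L := fun x => if hx : ∃ i, x ∈ (p i).1.1 then (p (Nat.find hx)).1.2 x else f x
  have hg : ∀ i, EqOn g (p i).1.2 (p i).1.1 := by
    intro i x hx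
    have hex : ∃ i, x ∈ (p i).1.1 := ⟨i, hx⟩
    simp only [g, dif_pos hex]
    exact ((hmono _ _ (Nat.find_min' hex hx)).2 (subset_closure (Nat.find_spec hex))).symm
  refine ⟨U, hU, ?_, g, ?_, ?_, ?_⟩
  · exact hFW0.trans (subset_iUnion (fun i => (p i).1.1) 0)
  · intro x hx
    obtain ⟨i, hi⟩ := mem_iUnion.1 hx
    refine ContinuousAt.continuousWithinAt ?_
    have hc : ContinuousAt (p i).1.2 x :=
      ((p i).2.2.mono subset_closure).continuousAt ((p i).2.1.mem_nhds hi)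
    refine hc.congr ?_
    filter_upwards [(p i).2.1.mem_nhds hi] with y hy
    exact (hg i hy).symm
  · intro x hx
    rw [hg 0 (hFW0 hx)]
    exact hff0 hx
  · apply htest _ hU.isClosed_compl
    intro i
    obtain ⟨h', h1, h2⟩ := hn3 i (p i)
    have hsub : Uᶜ ⊆ ((nx i (p i)).1.1)ᶜ :=
      compl_subset_compl.2 (subset_iUnion (fun i => (p i).1.1) (i + 1))
    exact ⟨h', h1.mono hsub, h2.mono (inter_subset_inter_right _ hsub)⟩

theorem LIndLE_of_EP_metric {L : Type} [TopologicalSpace L] [CompactSpace L] [Nonempty L]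
    (h1 : EmbR L) (h2 : ME L) (k : ℕ) : ∀ {X : Type} [MetricSpace X] [CompactSpace X],
    EP (JoinPow L k) X → LIndLE L X (k : Ordinal.{0}) := by
  induction k with
  | zero =>
    intro X _ _ h
    have h' : EP L X := h
    exact LIndLE_of_EP h' _
  | succ k ih =>
    intro X _ _ h
    obtain ⟨i1, i2, i3, i4⟩ := joinPow_props L h1 h2 k
    rw [LIndLE_iff]
    intro F hF f hf
    have h' : EP (Join L (JoinPow L k)) X := h
    obtain ⟨U, hU, hFU, g, hg, hgf, hP⟩ := partition_metric (NE_of_ME h1 h2) (NE_of_ME i3 i4) i3 h'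
      hF f hf
    refine ⟨U, hU, hFU, g, hg, hgf, Or.inr ⟨k, ?_, ?_⟩⟩
    · exact_mod_cast Nat.lt_succ_self k
    · have : CompactSpace ↥Uᶜ := isCompact_iff_compactSpace.1 hU.isClosed_compl.isCompact
      exact ih hP

theorem clopen_partition {X : Type} [TopologicalSpace X] [CompactSpace X] (Q : Set X → Prop)
    (h0 : Q ∅) (hm : ∀ D E, IsClopen E → E ⊆ D → Q D → Q E)
    (h : ∀ x, ∃ D, IsClopen D ∧ x ∈ D ∧ Q D) :
    ∃ (J : Type) (_ : Finite J) (_ : TopologicalSpace J) (_ : DiscreteTopology J) (κ : X → J),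
      Continuous κ ∧ ∀ j, Q (κ ⁻¹' {j}) := by
  choose D hD hxD hQ using h
  obtain ⟨t, ht⟩ := isCompact_univ.elim_nhds_subcover D
    (fun x _ => (hD x).isOpen.mem_nhds (hxD x))
  have hκ : Continuous (fun x => fun i : t => (D i.1).boolIndicator x) :=
    continuous_pi (fun i => (continuous_boolIndicator_iff_isClopen _).2 (hD i.1))
  refine ⟨t → Bool, inferInstance, inferInstance, inferInstance,
    fun x => fun i => (D i.1).boolIndicator x, hκ, ?_⟩
  intro j
  by_cases hj : ∃ i, j i = true
  · obtain ⟨i, hi⟩ := hj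
    refine hm (D i.1) _ ?_ ?_ (hQ i.1)
    · exact ⟨(isClosed_discrete _).preimage hκ, (isOpen_discrete _).preimage hκ⟩
    · intro x hx
      have := congrFun (mem_singleton_iff.1 hx) i
      simp only [hi] at this
      exact (Set.mem_iff_boolIndicator _ _).2 this
  · convert h0
    rw [Set.eq_empty_iff_forall_notMem]
    intro x hx
    obtain ⟨y, hy, hxy⟩ := mem_iUnion₂.1 (ht.2 (mem_univ x))
    apply hj
    refine ⟨⟨y, hy⟩, ?_⟩
    rw [← mem_singleton_iff.1 hx]
    exact (Set.mem_iff_boolIndicator _ _).1 hxy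

theorem glue_fibres {X Y J : Type} [TopologicalSpace X] [TopologicalSpace Y] [TopologicalSpace J]
    [DiscreteTopology J] {κ : X → J} (hκ : Continuous κ) {U : J → Set X}
    {g : J → X → Y} (hg : ∀ j, ContinuousOn (g j) (U j ∩ κ ⁻¹' {j})) :
    ContinuousOn (fun x => g (κ x) x) {x | x ∈ U (κ x)} := by
  have hop : ∀ j, IsOpen (κ ⁻¹' {j}) := fun j => (isOpen_discrete _).preimage hκ
  intro x hx
  have h1 : ContinuousWithinAt (g (κ x)) {x | x ∈ U (κ x)} x := by
    refine (hg (κ x) x ⟨hx, rfl⟩).mono_of_mem_nhdsWithin ?_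
    filter_upwards [self_mem_nhdsWithin, mem_nhdsWithin_of_mem_nhds ((hop (κ x)).mem_nhds rfl)]
      with y hy hy2
    have e : κ y = κ x := hy2
    have hy' : y ∈ U (κ y) := hy
    rw [e] at hy'
    exact ⟨hy', hy2⟩
  refine h1.congr_of_eventuallyEq ?_ rfl
  filter_upwards [mem_nhdsWithin_of_mem_nhds ((hop (κ x)).mem_nhds rfl)] with y hy
  have e : κ y = κ x := hy
  rw [e]

theorem exists_clopen_component {X : Type} [TopologicalSpace X] [CompactSpace X] [T2Space X]
    (x : X) {U : Set X} (hU : IsOpen U) (h : connectedComponent x ⊆ U) :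
    ∃ D, IsClopen D ∧ x ∈ D ∧ D ⊆ U := by
  have hne : Nonempty { s : Set X // IsClopen s ∧ x ∈ s } := ⟨⟨Set.univ, isClopen_univ, mem_univ x⟩⟩
  obtain ⟨s, hs⟩ := exists_subset_nhds_of_isCompact
    (V := fun s : { s : Set X // IsClopen s ∧ x ∈ s } => s.1) (U := U)
    (by
      rintro ⟨s, hs, hxs⟩ ⟨t, ht, hxt⟩
      exact ⟨⟨s ∩ t, hs.inter ht, hxs, hxt⟩, inter_subset_left, inter_subset_right⟩)
    (fun s => s.2.1.isClosed.isCompact)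
    (by
      intro y hy
      rw [← connectedComponent_eq_iInter_isClopen] at hy
      exact hU.mem_nhds (h hy))
  exact ⟨s.1, s.2.1, s.2.2, hs⟩

theorem EP_of_components {J X : Type} [TopologicalSpace J] [Nonempty J] [TopologicalSpace X]
    [CompactSpace X] [T2Space X] (hJ : NE J) (h : ∀ x : X, EP J (connectedComponent x)) :
    EP J X := by
  intro F hF f hf
  obtain ⟨I, _, _, _, κ, hκ, hQ⟩ := clopen_partition
    (fun D : Set X => ∃ g : X → J, ContinuousOn g D ∧ EqOn g f (F ∩ D))
    ⟨f, by simp, by simp⟩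
    (by
      rintro D E _ hED ⟨g, hg, hgf⟩
      exact ⟨g, hg.mono hED, hgf.mono (inter_subset_inter_right _ hED)⟩)
    (by
      intro x
      have hK : IsClosed (connectedComponent x) := isClosed_connectedComponent
      obtain ⟨g, hg, hgf⟩ := (h x).push hF f (hf.mono inter_subset_left)
      obtain ⟨k, hk, hkF, hkK⟩ := glue_closed' hF hK f g hf hg hgf.symm
      obtain ⟨U, hU, hFU, g2, hg2, hg2k⟩ := hJ X _ (hF.union hK) k hk
      obtain ⟨D, hD, hxD, hDU⟩ := exists_clopen_component x hU (fun y hy => hFU (Or.inr hy))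
      exact ⟨D, hD, hxD, g2, hg2.mono hDU, fun y hy =>
        (hg2k (Or.inl hy.1)).trans (hkF hy.1)⟩)
  choose g hg hgf using hQ
  refine ⟨fun x => g (κ x) x, ?_, fun x hx => hgf (κ x) ⟨hx, rfl⟩⟩
  have := glue_fibres hκ (U := fun _ => Set.univ) (g := g) (by simpa using hg)
  simpa [continuousOn_univ] using this

theorem EP_iff_of_components {J X C : Type} [TopologicalSpace J] [Nonempty J] [TopologicalSpace X]
    [CompactSpace X] [T2Space X] [TopologicalSpace C] [Nonempty X] (hJ : NE J)
    (h : ∀ x : X, Nonempty (connectedComponent x ≃ₜ C)) : EP J X ↔ EP J C := by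
  constructor
  · intro hX
    let x : X := Classical.arbitrary X
    obtain ⟨e⟩ := h x
    have h1 : EP J (connectedComponent x) :=
      hX.of_emb (isClosed_connectedComponent.isClosedEmbedding_subtypeVal)
    exact h1.of_emb e.symm.isClosedEmbedding
  · intro hC
    refine EP_of_components hJ (fun x => ?_)
    obtain ⟨e⟩ := h x
    exact hC.of_emb e.isClosedEmbedding

theorem LIndLT_sum {L : Type} [TopologicalSpace L] [Nonempty L] {J : Type} [Finite J]
    [TopologicalSpace J] [DiscreteTopology J]
    {γ : Ordinal.{0}} {X : Type} [TopologicalSpace X] {κ : X → J} (hκ : Continuous κ)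
    (h : ∀ j, LIndLT L (↥(κ ⁻¹' {j})) γ) : LIndLT L X γ := by
  rcases isEmpty_or_nonempty X with he | hne
  · exact Or.inl he
  right
  have hex : ∀ j, ∃ β < γ, LIndLE L (↥(κ ⁻¹' {j})) β := by
    have hγ : ∃ β, β < γ := by
      rcases h (κ hne.some) with hh | ⟨β, hβ, _⟩
      · exact (hh.false ⟨hne.some, rfl⟩).elim
      · exact ⟨β, hβ⟩
    intro j
    rcases h j with hh | hh
    · obtain ⟨β, hβ⟩ := hγ
      exact ⟨β, hβ, LIndLE_of_isEmpty β⟩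
    · exact hh
  choose b hb hbP using hex
  have : Nonempty J := ⟨κ hne.some⟩
  obtain ⟨j0, hj0⟩ := Finite.exists_max b
  exact ⟨b j0, hb j0, LIndLE_sum hκ (fun j => (hbP j).mono (hj0 j))⟩

/-- glue partitions over the fibres of a map to a finite discrete space -/
theorem partition_sum {L : Type} [TopologicalSpace L] [Nonempty L] {J : Type} [Finite J]
    [TopologicalSpace J] [DiscreteTopology J]
    {γ : Ordinal.{0}} {X : Type} [TopologicalSpace X] {κ : X → J} (hκ : Continuous κ)
    (F : Set X) (f : X → L)
    (h : ∀ j, ∃ U : Set X, IsOpen U ∧ F ∩ κ ⁻¹' {j} ⊆ U ∧ ∃ g : X → L,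
      ContinuousOn g (U ∩ κ ⁻¹' {j}) ∧ EqOn g f (F ∩ κ ⁻¹' {j}) ∧
      LIndLT L (↥(κ ⁻¹' {j} \ U)) γ) :
    ∃ U : Set X, IsOpen U ∧ F ⊆ U ∧ ∃ g : X → L, ContinuousOn g U ∧ EqOn g f F ∧
        LIndLT L (↥(Uᶜ)) γ := by
  choose U hU hFU g hg hgf hP using h
  have hop : ∀ j, IsOpen (κ ⁻¹' {j}) := fun j => (isOpen_discrete _).preimage hκ
  have hUeq : {x | x ∈ U (κ x)} = ⋃ j, (κ ⁻¹' {j} ∩ U j) := by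
    ext x; simp
  have hUo : IsOpen {x | x ∈ U (κ x)} := by
    rw [hUeq]
    exact isOpen_iUnion (fun j => (hop j).inter (hU j))
  refine ⟨_, hUo, fun x hx => hFU (κ x) ⟨hx, rfl⟩, fun x => g (κ x) x, glue_fibres hκ hg,
    fun x hx => hgf (κ x) ⟨hx, rfl⟩, ?_⟩
  refine LIndLT_sum (κ := fun x => κ x.1) (hκ.comp continuous_subtype_val) ?_
  intro j
  refine (hP j).of_sub (e := fun x => x.1.1) ?_ ?_
  · refine hUo.isClosed_compl.isClosedEmbedding_subtypeVal.comp ?_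
    refine IsClosed.isClosedEmbedding_subtypeVal ?_
    exact (isClosed_discrete _).preimage (hκ.comp continuous_subtype_val)
  · rintro ⟨⟨x, hx⟩, hxj⟩
    have : κ x = j := hxj
    refine ⟨this, fun hh => hx ?_⟩
    show x ∈ U (κ x)
    rw [this]; exact hh

theorem LIndLE_prod_local {L : Type} [MetricSpace L] [CompactSpace L] [Nonempty L] (hL : NE L)
    {T : Type} [TopologicalSpace T] [CompactSpace T] [T2Space T] [TotallyDisconnectedSpace T]
    {Y : Type} [TopologicalSpace Y] [CompactSpace Y] [T2Space Y] {F : Set (T × Y)}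
    (hF : IsClosed F) (f : T × Y → L) (hf : ContinuousOn f F) (t : T) (U1 : Set Y)
    (hU1 : IsOpen U1) (hFU1 : {y | (t, y) ∈ F} ⊆ U1) (g1 : Y → L) (hg1 : ContinuousOn g1 U1)
    (hg1f : ∀ y, (t, y) ∈ F → g1 y = f (t, y)) :
    ∃ D, IsClopen D ∧ t ∈ D ∧ F ∩ Prod.fst ⁻¹' D ⊆ Prod.snd ⁻¹' U1 ∧ ∃ g : T × Y → L,
      ContinuousOn g (Prod.snd ⁻¹' U1 ∩ Prod.fst ⁻¹' D) ∧ EqOn g f (F ∩ Prod.fst ⁻¹' D) := by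
  obtain ⟨ε, hε, hclose⟩ := close_ext hL
  have hFt : IsClosed {y | (t, y) ∈ F} := hF.preimage (by fun_prop)
  obtain ⟨O, hO, hFO, hOU⟩ := normal_exists_closure_subset hFt hU1 hFU1
  have hsnd : ContinuousOn (fun p : T × Y => g1 p.2) (Prod.snd ⁻¹' U1) :=
    hg1.comp continuous_snd.continuousOn (fun p hp => hp)
  have hb1 : IsClosed (Prod.fst '' (F ∩ Prod.snd ⁻¹' Oᶜ)) := by
    refine (IsClosed.isCompact ?_).image continuous_fst |>.isClosed
    exact hF.inter (hO.isClosed_compl.preimage continuous_snd)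
  have hcF : IsClosed (F ∩ Prod.snd ⁻¹' (closure O)) :=
    hF.inter (isClosed_closure.preimage continuous_snd)
  have hb2 : IsClosed (Prod.fst '' ((F ∩ Prod.snd ⁻¹' (closure O)) ∩
      (fun p : T × Y => dist (f p) (g1 p.2)) ⁻¹' Ici ε)) := by
    refine (IsClosed.isCompact ?_).image continuous_fst |>.isClosed
    refine ContinuousOn.preimage_isClosed_of_isClosed ?_ hcF isClosed_Ici
    refine continuous_dist.comp_continuousOn ((hf.mono inter_subset_left).prodMk (hsnd.mono ?_))
    exact fun p hp => hOU hp.2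
  obtain ⟨D, hD, htD, hDs⟩ := compact_exists_isClopen_in_isOpen (x := t)
    (hb1.isOpen_compl.inter hb2.isOpen_compl) (by
      constructor
      · rintro ⟨⟨s, y⟩, ⟨hp, hy⟩, rfl⟩
        exact hy (hFO hp)
      · rintro ⟨⟨s, y⟩, ⟨⟨hp, _⟩, hy⟩, rfl⟩
        simp only [mem_preimage, mem_Ici, hg1f y hp, dist_self] at hy
        exact absurd hy (not_le.2 hε))
  have hFD : ∀ p ∈ F, p.1 ∈ D → p.2 ∈ O := by
    intro p hp hpD
    by_contra hn
    exact (hDs hpD).1 ⟨p, ⟨hp, hn⟩, rfl⟩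
  have hdist : ∀ p ∈ F, p.1 ∈ D → dist (f p) (g1 p.2) < ε := by
    intro p hp hpD
    by_contra hn
    exact (hDs hpD).2 ⟨p, ⟨⟨hp, subset_closure (hFD p hp hpD)⟩, not_lt.1 hn⟩, rfl⟩
  have hDc : IsClosed (Prod.fst ⁻¹' D : Set (T × Y)) := hD.isClosed.preimage continuous_fst
  let Z : Set (T × Y) := Prod.fst ⁻¹' D ∩ Prod.snd ⁻¹' (closure O)
  have hZ : IsClosed Z := hDc.inter (isClosed_closure.preimage continuous_snd)
  have hA1 : IsClosed (F ∩ Z) := hF.inter hZ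
  have hA2 : IsClosed (Z ∩ Prod.snd ⁻¹' Oᶜ) := hZ.inter (hO.isClosed_compl.preimage continuous_snd)
  have hZg : ContinuousOn (fun p : T × Y => g1 p.2) Z := hsnd.mono (fun p hp => hOU hp.2)
  obtain ⟨a, ha, ha1, ha2⟩ := glue_closed' hA1 hA2 f (fun p => g1 p.2) (hf.mono inter_subset_left)
    (hZg.mono inter_subset_left) (by
      rintro p ⟨⟨hp, hpZ⟩, _, hpO⟩
      exact absurd (hFD p hp hpZ.1) hpO)
  have : CompactSpace Z := isCompact_iff_compactSpace.1 hZ.isCompact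
  obtain ⟨k, hk, hka⟩ := hclose Z (Subtype.val ⁻¹' (F ∩ Z ∪ Z ∩ Prod.snd ⁻¹' Oᶜ))
    ((hA1.union hA2).preimage continuous_subtype_val) (fun p => a p.1) (fun p => g1 p.1.2)
    (ha.comp continuous_subtype_val.continuousOn (fun p hp => hp))
    (continuousOn_iff_continuous_domRestrict.1 hZg) (by
      rintro ⟨p, hpZ⟩ (hp | hp)
      · simp only
        rw [ha1 hp]
        exact hdist p hp.1 hpZ.1
      · simp only
        rw [ha2 hp, dist_self]
        exact hε)
  obtain ⟨k', hk', hkk⟩ := exists_total Z k hk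
  obtain ⟨g, hg, hg1', hg2'⟩ := glue_closed (S := Prod.snd ⁻¹' U1 ∩ Prod.fst ⁻¹' D)
    (A := Prod.snd ⁻¹' (closure O)) (B := Prod.snd ⁻¹' Oᶜ)
    (isClosed_closure.preimage continuous_snd) (hO.isClosed_compl.preimage continuous_snd)
    (by
      intro p _
      by_cases hp : p.2 ∈ O
      · exact Or.inl (subset_closure hp)
      · exact Or.inr hp) k' (fun p => g1 p.2)
    (hk'.mono (fun p hp => ⟨hp.1.2, hp.2⟩))
    (hsnd.mono (fun p hp => hp.1.1))
    (by
      rintro p ⟨⟨⟨hp1, hpD⟩, hpc⟩, hpO⟩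
      have hpZ : p ∈ Z := ⟨hpD, hpc⟩
      rw [hkk ⟨p, hpZ⟩, hka (x := ⟨p, hpZ⟩) (Or.inr ⟨hpZ, hpO⟩)]
      exact ha2 ⟨hpZ, hpO⟩)
  refine ⟨D, hD, htD, ?_, g, hg, ?_⟩
  · rintro p ⟨hp, hpD⟩
    exact hOU (subset_closure (hFD p hp hpD))
  · rintro p ⟨hp, hpD⟩
    have hpc : p.2 ∈ closure O := subset_closure (hFD p hp hpD)
    have hpZ : p ∈ Z := ⟨hpD, hpc⟩
    rw [hg1' ⟨⟨hOU hpc, hpD⟩, hpc⟩, hkk ⟨p, hpZ⟩, hka (x := ⟨p, hpZ⟩) (Or.inl ⟨hp, hpZ⟩)]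
    exact ha1 ⟨hp, hpZ⟩

theorem LIndLE_prod {L : Type} [MetricSpace L] [CompactSpace L] [Nonempty L] (hL : NE L)
    {T : Type} [TopologicalSpace T] [CompactSpace T] [T2Space T] [TotallyDisconnectedSpace T]
    {α : Ordinal.{0}} : ∀ {Y : Type} [TopologicalSpace Y] [CompactSpace Y] [T2Space Y],
      LIndLE L Y α → LIndLE L (T × Y) α := by
  induction α using WellFoundedLT.induction with
  | ind α ih =>
    intro Y _ _ _ h
    rw [LIndLE_iff] at h ⊢
    intro F hF f hf
    obtain ⟨J, _, _, _, κ, hκ, hQ⟩ := clopen_partition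
      (fun D : Set T => ∃ U : Set (T × Y), IsOpen U ∧ F ∩ Prod.fst ⁻¹' D ⊆ U ∧ ∃ g : T × Y → L,
        ContinuousOn g (U ∩ Prod.fst ⁻¹' D) ∧ EqOn g f (F ∩ Prod.fst ⁻¹' D) ∧
        LIndLT L (↥(Prod.fst ⁻¹' D \ U)) α)
      ⟨∅, isOpen_empty, by simp, f, by simp, by simp, Or.inl (by simp)⟩
      (by
        rintro D E hE hED ⟨U, hU, hFU, g, hg, hgf, hP⟩
        have hs : (Prod.fst ⁻¹' E : Set (T × Y)) ⊆ Prod.fst ⁻¹' D := preimage_mono hED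
        refine ⟨U, hU, fun x hx => hFU ⟨hx.1, hs hx.2⟩, g, hg.mono ?_, hgf.mono ?_, ?_⟩
        · exact fun x hx => ⟨hx.1, hs hx.2⟩
        · exact fun x hx => ⟨hx.1, hs hx.2⟩
        · exact hP.subset ((hE.isClosed.preimage continuous_fst).sdiff hU)
            (sdiff_subset_sdiff_left hs))
      (by
        intro t
        obtain ⟨U1, hU1, hFU1, g1, hg1, hg1f, hP⟩ := h {y | (t, y) ∈ F} (hF.preimage (by fun_prop))
          (fun y => f (t, y)) (hf.comp (by fun_prop) (fun y hy => hy))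
        obtain ⟨D, hD, htD, h1, g, h2, h3⟩ := LIndLE_prod_local hL hF f hf t U1 hU1 hFU1 g1 hg1
          (fun y hy => hg1f hy)
        refine ⟨D, hD, htD, _, hU1.preimage continuous_snd, h1, g, h2, h3, ?_⟩
        rcases hP with hP | ⟨β, hβ, hP⟩
        · exact Or.inl ⟨fun p => hP.false ⟨p.1.2, p.2.2⟩⟩
        · right
          have hc1 : CompactSpace ↥U1ᶜ := isCompact_iff_compactSpace.1 hU1.isClosed_compl.isCompact
          have hcl : IsClosed (Prod.fst ⁻¹' D \ Prod.snd ⁻¹' U1 : Set (T × Y)) :=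
            (hD.isClosed.preimage continuous_fst).sdiff (hU1.preimage continuous_snd)
          have hc2 : CompactSpace ↥(Prod.fst ⁻¹' D \ Prod.snd ⁻¹' U1 : Set (T × Y)) :=
            isCompact_iff_compactSpace.1 hcl.isCompact
          have hc : Continuous (fun p : ↥(Prod.fst ⁻¹' D \ Prod.snd ⁻¹' U1 : Set (T × Y)) =>
              ((p.1.1, ⟨p.1.2, p.2.2⟩) : T × ↥U1ᶜ)) :=
            (continuous_fst.comp continuous_subtype_val).prodMk
              ((continuous_snd.comp continuous_subtype_val).subtype_mk _)
          refine ⟨β, hβ, (ih β hβ hP).of_emb (hc.isClosedEmbedding ?_)⟩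
          rintro ⟨⟨a, b⟩, hp⟩ ⟨⟨a', b'⟩, hp'⟩ hpp
          simp only [Prod.mk.injEq, Subtype.mk.injEq] at hpp
          simp [hpp.1, hpp.2])
    exact partition_sum (κ := fun p : T × Y => κ p.1) (hκ.comp continuous_fst) F f hQ

/-- Strong `α`-dimensionality: no partition of dimension `< α` is without obstruction points. -/
def Strong (L X : Type) [TopologicalSpace L] [TopologicalSpace X] (α : Ordinal.{0}) : Prop :=
  ∃ F : Set X, IsClosed F ∧ ∃ f : X → L, ContinuousOn f F ∧
    ∀ U : Set X, IsOpen U → F ⊆ U → ∀ g : X → L, ContinuousOn g U → EqOn g f F →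
      LIndLT L (↥(Uᶜ)) α → ¬ ∃ g' : X → L, ContinuousOn g' (closure U) ∧ EqOn g' g U

theorem Strong_succ {L X : Type} [TopologicalSpace L] [Nonempty L] [TopologicalSpace X]
    {α : Ordinal.{0}} (h : ¬ LIndLE L X α) : Strong L X (Order.succ α) := by
  rw [LIndLE_iff] at h
  push Not at h
  obtain ⟨F, hF, f, hf, h⟩ := h
  refine ⟨F, hF, f, hf, ?_⟩
  rintro U hU hFU g hg hgf hP ⟨g', hg', hgg⟩
  have hP' : LIndLE L (↥(Uᶜ)) α := by
    rcases hP with hP | ⟨β, hβ, hP⟩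
    · exact LIndLE_of_isEmpty _
    · exact hP.mono (Order.lt_succ_iff.1 hβ)
  obtain ⟨V, hV, hVs, g2, hg2, hg2e, hQ⟩ := hP'.push_set hU.isClosed_compl
    (isClosed_closure (s := U)) g' (hg'.mono inter_subset_left)
  obtain ⟨k, hk, hk1, hk2⟩ := glue_closed (S := U ∪ V) (A := closure U) (B := Uᶜ) isClosed_closure
    hU.isClosed_compl (fun x _ => by
      by_cases hx : x ∈ U
      · exact Or.inl (subset_closure hx)
      · exact Or.inr hx) g' g2 (hg'.mono inter_subset_right)
    (hg2.mono (fun x hx => ⟨hx.1.resolve_left hx.2, hx.2⟩))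
    (fun x hx => (hg2e ⟨hx.1.2, hx.2⟩).symm)
  refine h (U ∪ V) (hU.union hV) (hFU.trans subset_union_left) k hk ?_ ?_
  · intro x hx
    rw [hk1 ⟨Or.inl (hFU hx), subset_closure (hFU hx)⟩, hgg (hFU hx), hgf hx]
  · refine hQ.subset (hU.union hV).isClosed_compl ?_
    intro x hx
    exact ⟨fun h' => hx (Or.inl h'), fun h' => hx (Or.inr h')⟩

/-- Corson property: continuous injection in a Sigma-product of lines. -/
def Corson (X : Type) [TopologicalSpace X] : Prop :=
  ∃ (Γ : Type) (e : X → Γ → ℝ), Continuous e ∧ Function.Injective e ∧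
    ∀ x, {γ | e x γ ≠ 0}.Countable

theorem Corson_of_EmbR {X : Type} [TopologicalSpace X] (h : EmbR X) : Corson X := by
  obtain ⟨e, he, hi⟩ := h
  exact ⟨ℕ, e, he, hi, fun x => Set.to_countable _⟩

theorem Corson.prod {X Y : Type} [TopologicalSpace X] [TopologicalSpace Y] (hX : Corson X)
    (hY : Corson Y) : Corson (X × Y) := by
  obtain ⟨Γ, e, he, hi, hs⟩ := hX
  obtain ⟨Δ, d, hd, hj, ht⟩ := hY
  refine ⟨Γ ⊕ Δ, fun p => Sum.elim (e p.1) (d p.2), ?_, ?_, ?_⟩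
  · rw [continuous_pi_iff]
    rintro (γ | δ)
    · exact ((continuous_apply γ).comp he).comp continuous_fst
    · exact ((continuous_apply δ).comp hd).comp continuous_snd
  · rintro ⟨a, b⟩ ⟨a', b'⟩ h
    have h1 : e a = e a' := funext fun γ => congrFun h (Sum.inl γ)
    have h2 : d b = d b' := funext fun γ => congrFun h (Sum.inr γ)
    rw [hi h1, hj h2]
  · intro p
    refine (((hs p.1).image Sum.inl).union ((ht p.2).image Sum.inr)).mono ?_
    rintro (γ | δ) h
    · exact Or.inl ⟨γ, h, rfl⟩
    · exact Or.inr ⟨δ, h, rfl⟩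

theorem Corson_onePoint : Corson (OnePoint ℕ) := by
  refine ⟨ℕ, fun p n => if p = (n : OnePoint ℕ) then 1 else 0, ?_, ?_, fun x => Set.to_countable _⟩
  · rw [continuous_pi_iff]
    intro n
    have hc : IsClopen ({(n : OnePoint ℕ)} : Set (OnePoint ℕ)) := by
      refine ⟨isClosed_singleton, ?_⟩
      have := OnePoint.isOpenEmbedding_coe (X := ℕ) |>.isOpenMap {n} (isOpen_discrete _)
      simpa using this
    have := (continuous_const (y := (1 : ℝ))).if (p := fun p => p ∈ ({(n : OnePoint ℕ)} : Set (OnePoint ℕ)))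
      (g := fun _ => (0 : ℝ)) (by
        intro a ha
        have h2 : frontier ({(n : OnePoint ℕ)} : Set (OnePoint ℕ)) = ∅ := hc.frontier_eq
        have ha' : a ∈ frontier ({(n : OnePoint ℕ)} : Set (OnePoint ℕ)) := ha
        rw [h2] at ha'
        exact ha'.elim) continuous_const
    simpa using this
  · intro p q h
    induction p using OnePoint.rec with
    | infty =>
      induction q using OnePoint.rec with
      | infty => rfl
      | coe m =>
        have := congrFun h m
        simp at this
    | coe n =>
      have := congrFun h n
      simp only [if_true] at this
      by_contra hn
      have hn' : ¬ q = (n : OnePoint ℕ) := fun h' => hn h'.symm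
      rw [if_neg hn'] at this
      exact one_ne_zero this

theorem Corson.frechet {X : Type} [TopologicalSpace X] [CompactSpace X] (h : Corson X) :
    FrechetUrysohnSpace X := by
  obtain ⟨Γ, e, he, hi, hs⟩ := h
  have hemb := (he.isClosedEmbedding hi).isEmbedding
  constructor
  intro s z hz
  rcases isEmpty_or_nonempty Γ with hΓ | hΓ
  · have hsub : ∀ x y : X, x = y := fun x y => hi (Subsingleton.elim _ _)
    obtain ⟨a, ha⟩ := closure_nonempty_iff.1 ⟨z, hz⟩
    exact ⟨fun _ => a, fun _ => ha, by rw [hsub a z]; exact tendsto_const_nhds⟩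
  have hE : ∀ x, ∃ E : ℕ → Γ, {γ | e x γ ≠ 0} ⊆ range E := by
    intro x
    rcases ({γ | e x γ ≠ 0} : Set Γ).eq_empty_or_nonempty with h0 | h0
    · exact ⟨fun _ => Classical.arbitrary Γ, by rw [h0]; exact empty_subset _⟩
    · obtain ⟨E, hE⟩ := (hs x).exists_eq_range h0
      exact ⟨E, hE.le⟩
  choose E hE using hE
  have hstep : ∀ (G : Finset X) (k : ℕ), ∃ a ∈ s, ∀ y, (y = z ∨ y ∈ G) → ∀ m < k,
      |e a (E y m) - e z (E y m)| < 1 / ((k : ℝ) + 1) := by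
    intro G k
    let N : Set X := ⋂ y ∈ insert z G, ⋂ m ∈ Finset.range k,
      {x | |e x (E y m) - e z (E y m)| < 1 / ((k : ℝ) + 1)}
    have hN : IsOpen N := by
      refine isOpen_biInter_finset fun y _ => isOpen_biInter_finset fun m _ => ?_
      have hc : Continuous (fun x => e x (E y m)) := (continuous_apply _).comp he
      exact isOpen_lt (by fun_prop) continuous_const
    have hzN : z ∈ N := by
      simp only [N, mem_iInter, mem_setOf_eq, sub_self, abs_zero]
      intro _ _ _ _
      positivity
    obtain ⟨a, haN, has⟩ := mem_closure_iff.1 hz N hN hzN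
    refine ⟨a, has, ?_⟩
    intro y hy m hm
    simp only [N, mem_iInter, mem_setOf_eq] at haN
    exact haN y (Finset.mem_insert.2 hy) m (Finset.mem_range.2 hm)
  choose a has ha using hstep
  let G : ℕ → Finset X := fun n => Nat.rec ∅ (fun k H => insert (a H k) H) n
  have hG : ∀ k, G (k + 1) = insert (a (G k) k) (G k) := fun k => rfl
  have hmem : ∀ j k, j < k → a (G j) j ∈ G k := by
    intro j k hjk
    induction k, hjk using Nat.le_induction with
    | base => rw [hG]; exact Finset.mem_insert_self _ _
    | succ k hk ih => rw [hG]; exact Finset.mem_insert_of_mem ih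
  refine ⟨fun k => a (G k) k, fun k => has _ _, ?_⟩
  rw [hemb.tendsto_nhds_iff, tendsto_pi_nhds]
  intro γ
  have hlim : ∀ (y : X) (m N : ℕ), (∀ k ≥ N, y = z ∨ y ∈ G k) → E y m = γ →
      Filter.Tendsto (fun k => e (a (G k) k) γ) Filter.atTop (𝓝 (e z γ)) := by
    intro y m N hy hγ
    rw [tendsto_iff_dist_tendsto_zero]
    refine squeeze_zero' (Filter.Eventually.of_forall fun k => dist_nonneg) ?_
      tendsto_one_div_add_atTop_nhds_zero_nat
    filter_upwards [Filter.eventually_ge_atTop N, Filter.eventually_gt_atTop m] with k hk hm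
    have := ha (G k) k y (hy k hk) m hm
    rw [hγ] at this
    exact this.le
  by_cases h1 : e z γ ≠ 0
  · obtain ⟨m, hm⟩ := hE z h1
    exact hlim z m 0 (fun k _ => Or.inl rfl) hm
  by_cases h2 : ∃ j, e (a (G j) j) γ ≠ 0
  · obtain ⟨j, hj⟩ := h2
    obtain ⟨m, hm⟩ := hE _ hj
    exact hlim _ m (j + 1) (fun k hk => Or.inr (hmem j k hk)) hm
  · push Not at h1 h2
    simp only [Function.comp_def, h1, h2]
    exact tendsto_const_nhds

/-- The construction `T(X,W,r)`: a copy of `X` together with isolated copies of the `W i`. -/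
structure TData {X : Type} [TopologicalSpace X] {ι : Type} {W : ι → Type}
    [∀ i, TopologicalSpace (W i)] (r : ∀ i, W i → X) (Z : Type) [TopologicalSpace Z] where
  inl : X → Z
  inn : ∀ i, W i → Z
  R : Z → X
  cinl : Continuous inl
  cinn : ∀ i, Continuous (inn i)
  cR : Continuous R
  Rinl : ∀ x, R (inl x) = x
  Rinn : ∀ i w, R (inn i w) = r i w
  inj : ∀ i, Function.Injective (inn i)
  ne : ∀ x i w, inl x ≠ inn i w
  ne' : ∀ i j v w, inn i v = inn j w → i = j
  cover : ∀ z, (∃ x, inl x = z) ∨ ∃ i w, inn i w = z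
  op : ∀ i, IsOpen (Set.range (inn i))

def TPhi {X : Type} {ι : Type} {W : ι → Type} (r : ∀ i, W i → X) :
    (X ⊕ Σ i, W i) → X × ∀ i, W i ⊕ Unit
  | Sum.inl x => (x, fun _ => Sum.inr ())
  | Sum.inr ⟨i, w⟩ => (r i w, fun j => if h : i = j then Sum.inl (h ▸ w) else Sum.inr ())

theorem exists_TData {X : Type} [TopologicalSpace X] [CompactSpace X] [T2Space X] {ι : Type}
    {W : ι → Type} [∀ i, TopologicalSpace (W i)] [∀ i, CompactSpace (W i)] [∀ i, T2Space (W i)]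
    (r : ∀ i, W i → X) (hr : ∀ i, Continuous (r i)) :
    ∃ (Z : Type) (tZ : TopologicalSpace Z),
      letI := tZ
      CompactSpace Z ∧ T2Space Z ∧ Nonempty (TData r Z) := by
  let Z := X ⊕ Σ i, W i
  let Φ : Z → X × ∀ i, W i ⊕ Unit := TPhi r
  let tZ : TopologicalSpace Z := TopologicalSpace.induced Φ inferInstance
  have hΦl : ∀ x, Φ (Sum.inl x) = (x, fun _ => Sum.inr ()) := fun x => rfl
  have hΦr1 : ∀ i w, (Φ (Sum.inr ⟨i, w⟩)).1 = r i w := fun i w => rfl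
  have hΦr2 : ∀ i w, (Φ (Sum.inr ⟨i, w⟩)).2 i = Sum.inl w := by
    intro i w; simp [Φ, TPhi]
  have hΦr3 : ∀ i w j, i ≠ j → (Φ (Sum.inr ⟨i, w⟩)).2 j = Sum.inr () := by
    intro i w j h; simp [Φ, TPhi, h]
  have hinj : Function.Injective Φ := by
    rintro (x | ⟨i, w⟩) (y | ⟨j, v⟩) h
    · rw [hΦl, hΦl] at h
      exact congrArg Sum.inl (Prod.ext_iff.1 h).1
    · have h2 := congrFun (Prod.ext_iff.1 h).2 j
      rw [hΦr2, hΦl] at h2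
      simp at h2
    · have h2 := congrFun (Prod.ext_iff.1 h).2 i
      rw [hΦr2, hΦl] at h2
      simp at h2
    · have h2 := congrFun (Prod.ext_iff.1 h).2 i
      rw [hΦr2] at h2
      by_cases hij : j = i
      · subst hij
        rw [hΦr2] at h2
        rw [Sum.inl.inj h2]
      · rw [hΦr3 j v i hij] at h2
        simp at h2
  have hemb : @IsEmbedding _ _ tZ _ Φ := ⟨⟨rfl⟩, hinj⟩
  have hΦc : @Continuous _ _ tZ _ Φ := hemb.continuous
  have hrange : Set.range Φ = {p | (∀ i j, i ≠ j → p.2 i = Sum.inr () ∨ p.2 j = Sum.inr ()) ∧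
      ∀ i, p.2 i = Sum.inr () ∨ (p.1, p.2 i) ∈ Set.range (fun w : W i => (r i w, (Sum.inl w : W i ⊕ Unit)))} := by
    ext p
    constructor
    · rintro ⟨z, rfl⟩
      rcases z with x | ⟨i, w⟩
      · exact ⟨fun i j _ => Or.inl rfl, fun i => Or.inl rfl⟩
      · refine ⟨fun j k hjk => ?_, fun j => ?_⟩
        · by_cases h : i = j
          · right; exact hΦr3 _ _ _ (fun h' => hjk (h.symm.trans h'))
          · left; exact hΦr3 _ _ _ h
        · by_cases h : i = j
          · subst h
            right
            exact ⟨w, by rw [hΦr2, hΦr1]⟩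
          · left; exact hΦr3 _ _ _ h
    · rintro ⟨h1, h2⟩
      by_cases h : ∀ i, p.2 i = Sum.inr ()
      · exact ⟨Sum.inl p.1, by rw [hΦl]; exact Prod.ext rfl (funext fun i => (h i).symm)⟩
      · push Not at h
        obtain ⟨i, hi⟩ := h
        obtain ⟨w, hw⟩ := (h2 i).resolve_left hi
        have hw1 : r i w = p.1 := (Prod.ext_iff.1 hw).1
        have hw2 : Sum.inl w = p.2 i := (Prod.ext_iff.1 hw).2
        refine ⟨Sum.inr ⟨i, w⟩, Prod.ext hw1 (funext fun j => ?_)⟩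
        by_cases hij : i = j
        · subst hij; rw [hΦr2, hw2]
        · rw [hΦr3 _ _ _ hij]
          exact ((h1 i j hij).resolve_left hi).symm
  have hclosed : IsClosed (Set.range Φ) := by
    rw [hrange]
    have c2 : ∀ i, Continuous fun p : X × ∀ i, W i ⊕ Unit => p.2 i := fun i => by fun_prop
    have hs : ∀ i, IsClosed {p : X × ∀ i, W i ⊕ Unit | p.2 i = Sum.inr ()} := fun i =>
      isClosed_eq (c2 i) continuous_const
    have := ((isClosed_iInter fun i => isClosed_iInter fun j => isClosed_iInter fun _ : i ≠ j =>
      (hs i).union (hs j)).inter (isClosed_iInter fun i => (hs i).union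
        ((isCompact_range ((hr i).prodMk continuous_inl)).isClosed.preimage
          (continuous_fst.prodMk (c2 i)))))
    convert this using 1
    ext p
    simp [Set.mem_iInter]
  have hce : @IsClosedEmbedding _ _ tZ _ Φ := ⟨hemb, hclosed⟩
  refine ⟨Z, tZ, hce.compactSpace, hemb.t2Space, ⟨?_⟩⟩
  letI := tZ
  refine ⟨Sum.inl, fun i w => Sum.inr ⟨i, w⟩, fun z => (Φ z).1, ?_, ?_, ?_, ?_, ?_, ?_, ?_, ?_, ?_, ?_⟩
  · rw [hemb.continuous_iff]
    exact continuous_id.prodMk continuous_const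
  · intro i
    rw [hemb.continuous_iff]
    refine (hr i).prodMk (continuous_pi fun j => ?_)
    by_cases h : i = j
    · subst h
      have : (fun w => (Φ (Sum.inr ⟨i, w⟩)).2 i) = Sum.inl := funext (hΦr2 i)
      have h3 : Continuous (fun w => (Φ (Sum.inr ⟨i, w⟩)).2 i) := by rw [this]; exact continuous_inl
      exact h3
    · have : (fun w => (Φ (Sum.inr ⟨i, w⟩)).2 j) = fun _ => Sum.inr () := funext fun w => hΦr3 i w j h
      have h3 : Continuous (fun w => (Φ (Sum.inr ⟨i, w⟩)).2 j) := by rw [this]; exact continuous_const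
      exact h3
  · exact continuous_fst.comp hΦc
  · intro x; rfl
  · intro i w; rfl
  · intro i v w h
    have h2 := congrArg (fun z => (Φ z).2 i) h
    simp only [hΦr2] at h2
    exact Sum.inl.inj h2
  · intro x i w h; cases h
  · intro i j v w h
    cases h; rfl
  · rintro (x | ⟨i, w⟩)
    · exact Or.inl ⟨x, rfl⟩
    · exact Or.inr ⟨i, w, rfl⟩
  · intro i
    have : Set.range (fun w : W i => (Sum.inr ⟨i, w⟩ : Z)) =
        (fun z => (Φ z).2 i) ⁻¹' Set.range Sum.inl := by
      ext z
      constructor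
      · rintro ⟨w, rfl⟩
        exact ⟨w, (hΦr2 i w).symm⟩
      · rintro ⟨w, hw⟩
        rcases z with x | ⟨j, v⟩
        · have : (Sum.inl w : W i ⊕ Unit) = Sum.inr () := hw
          cases this
        · by_cases h : j = i
          · subst h; exact ⟨v, rfl⟩
          · have h3 := hΦr3 j v i h
            have : (Sum.inl w : W i ⊕ Unit) = Sum.inr () := hw.trans h3
            cases this
    rw [this]
    exact isOpen_range_inl.preimage (((continuous_apply i).comp continuous_snd).comp hΦc)

section TD
set_option linter.unusedSectionVars false
variable {X : Type} [TopologicalSpace X] [CompactSpace X] [T2Space X] {ι : Type}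
    {W : ι → Type} [∀ i, TopologicalSpace (W i)] [∀ i, CompactSpace (W i)]
    {r : ∀ i, W i → X} {Z : Type} [TopologicalSpace Z] [CompactSpace Z] [T2Space Z]

theorem TData.einl (T : TData r Z) : IsClosedEmbedding T.inl :=
  T.cinl.isClosedEmbedding (Function.LeftInverse.injective T.Rinl)

theorem TData.einn (T : TData r Z) (i : ι) : IsClosedEmbedding (T.inn i) :=
  (T.cinn i).isClosedEmbedding (T.inj i)

theorem TData.clop (T : TData r Z) (i : ι) : IsClopen (Set.range (T.inn i)) :=
  ⟨(T.einn i).isClosed_range, T.op i⟩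

theorem TData.einno (T : TData r Z) (i : ι) : IsOpenEmbedding (T.inn i) :=
  ⟨(T.einn i).isEmbedding, T.op i⟩

theorem TData.finite (T : TData r Z) {F : Set Z} (hF : IsClosed F) (hd : ∀ x, T.inl x ∉ F) :
    {i | ∃ w, T.inn i w ∈ F}.Finite := by
  obtain ⟨t, ht⟩ := hF.isCompact.elim_finite_subcover (fun i => Set.range (T.inn i)) T.op (by
    intro z hz
    rcases T.cover z with ⟨x, rfl⟩ | ⟨i, w, rfl⟩
    · exact (hd x hz).elim
    · exact Set.mem_iUnion.2 ⟨i, w, rfl⟩)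
  refine t.finite_toSet.subset ?_
  rintro i ⟨w, hw⟩
  obtain ⟨j, hj, v, hv⟩ := Set.mem_iUnion₂.1 (ht hw)
  rw [← T.ne' _ _ _ _ hv]
  exact hj

theorem component_emb {A Y : Type} [TopologicalSpace A] [TopologicalSpace Y] {e : A → Y}
    (he : IsEmbedding e) (a : A) (h : connectedComponent (e a) ⊆ Set.range e) :
    Nonempty (connectedComponent (e a) ≃ₜ connectedComponent a) := by
  have him : e '' connectedComponent a = connectedComponent (e a) := by
    apply Set.Subset.antisymm
    · exact (isPreconnected_connectedComponent.image e he.continuous.continuousOn).subset_connectedComponent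
        ⟨a, mem_connectedComponent, rfl⟩
    · intro y hy
      obtain ⟨b, rfl⟩ := h hy
      refine ⟨b, ?_, rfl⟩
      have hp : IsPreconnected (e ⁻¹' connectedComponent (e a)) := by
        rw [← he.isInducing.isPreconnected_image, Set.image_preimage_eq_of_subset h]
        exact isPreconnected_connectedComponent
      exact hp.subset_connectedComponent (mem_connectedComponent (x := e a)) hy
  exact ⟨((he.homeomorphImage _).trans (Homeomorph.setCongr him)).symm⟩

theorem TData.comps (T : TData r Z) {C : Type} [TopologicalSpace C]
    (hX : ∀ x : X, Nonempty (connectedComponent x ≃ₜ C))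
    (hW : ∀ i, ∀ x : W i, Nonempty (connectedComponent x ≃ₜ C)) :
    ∀ z : Z, Nonempty (connectedComponent z ≃ₜ C) := by
  intro z
  rcases T.cover z with ⟨x, rfl⟩ | ⟨i, w, rfl⟩
  · obtain ⟨k⟩ := hX x
    obtain ⟨h⟩ := component_emb T.einl.isEmbedding x (by
      intro z hz
      rcases T.cover z with ⟨y, rfl⟩ | ⟨i, w, rfl⟩
      · exact ⟨y, rfl⟩
      · exfalso
        have hc := (T.clop i).compl
        have := isPreconnected_connectedComponent.subset_isClopen hc
          ⟨T.inl x, mem_connectedComponent, by rintro ⟨w, hw⟩; exact T.ne x i w hw.symm⟩ hz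
        exact this ⟨w, rfl⟩)
    exact ⟨h.trans k⟩
  · obtain ⟨k⟩ := hW i w
    obtain ⟨h⟩ := component_emb (T.einn i).isEmbedding w
      (isPreconnected_connectedComponent.subset_isClopen (T.clop i)
        ⟨_, mem_connectedComponent, w, rfl⟩)
    exact ⟨h.trans k⟩

theorem prod_comps {S C : Type} [TopologicalSpace S] [TotallyDisconnectedSpace S] [T1Space S]
    [TopologicalSpace C]
    (hX : ∀ x : X, Nonempty (connectedComponent x ≃ₜ C)) :
    ∀ p : S × X, Nonempty (connectedComponent p ≃ₜ C) := by
  rintro ⟨s, x⟩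
  obtain ⟨k⟩ := hX x
  obtain ⟨h⟩ := component_emb (e := fun x : X => (s, x)) (isEmbedding_prodMkRight s) x (by
      rintro ⟨t, y⟩ hz
      have h2 := ((isPreconnected_connectedComponent (x := (s, x))).image Prod.fst
        continuous_fst.continuousOn).subsingleton ⟨_, hz, rfl⟩ ⟨_, mem_connectedComponent, rfl⟩
      simp only at h2
      exact ⟨y, by rw [h2]⟩)
  exact ⟨h.trans k⟩

theorem TData.continuous_extend (T : TData r Z) (i : ι) {φ : W i → ℝ} (hφ : Continuous φ) :
    Continuous (Function.extend (T.inn i) φ 0) := by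
  rw [continuous_iff_continuousAt]
  intro z
  by_cases hz : z ∈ Set.range (T.inn i)
  · obtain ⟨w, rfl⟩ := hz
    rw [← (T.einno i).continuousAt_iff]
    have hcomp : Function.extend (T.inn i) φ 0 ∘ T.inn i = φ :=
      funext fun w => (T.inj i).extend_apply _ _ _
    rw [hcomp]
    exact hφ.continuousAt
  · have : Function.extend (T.inn i) φ 0 =ᶠ[𝓝 z] fun _ => 0 := by
      filter_upwards [(T.clop i).compl.isOpen.mem_nhds hz] with y hy
      rw [Function.extend_apply' _ _ _ hy]
      rfl
    exact continuousAt_const.congr this.symm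

theorem TData.corson (T : TData r Z) (hX : Corson X) (hW : ∀ i, Corson (W i)) : Corson Z := by
  obtain ⟨Γ, e, he, hi, hs⟩ := hX
  choose Δ d hd hj ht using hW
  let φ : ∀ i, Option (Δ i) → W i → ℝ := fun i o w => match o with
    | none => 1
    | some γ => d i w γ
  have hφ : ∀ i o, Continuous (φ i o) := by
    intro i o
    cases o with
    | none => exact continuous_const
    | some γ => exact (continuous_apply γ).comp (hd i)
  have ext1 : ∀ i w o, Function.extend (T.inn i) (φ i o) 0 (T.inn i w) = φ i o w := fun i w o =>
    (T.inj i).extend_apply _ _ _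
  have ext2 : ∀ i x o, Function.extend (T.inn i) (φ i o) 0 (T.inl x) = 0 := fun i x o =>
    Function.extend_apply' _ _ _ (by rintro ⟨w, hw⟩; exact T.ne _ _ _ hw.symm)
  have ext3 : ∀ i j w o, i ≠ j → Function.extend (T.inn i) (φ i o) 0 (T.inn j w) = 0 := fun i j w o h =>
    Function.extend_apply' _ _ _ (by rintro ⟨v, hv⟩; exact h (T.ne' _ _ _ _ hv))
  refine ⟨Γ ⊕ Σ i, Option (Δ i), fun z => Sum.elim (e (T.R z))
    (fun p => Function.extend (T.inn p.1) (φ p.1 p.2) 0 z), ?_, ?_, ?_⟩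
  · rw [continuous_pi_iff]
    rintro (γ | ⟨i, o⟩)
    · exact ((continuous_apply γ).comp he).comp T.cR
    · exact T.continuous_extend i (hφ i o)
  · intro z z' h
    have h1 : e (T.R z) = e (T.R z') := funext fun γ => congrFun h (Sum.inl γ)
    have h2 : ∀ i o, Function.extend (T.inn i) (φ i o) 0 z = Function.extend (T.inn i) (φ i o) 0 z' :=
      fun i o => congrFun h (Sum.inr ⟨i, o⟩)
    have h1' := hi h1
    rcases T.cover z with ⟨x, rfl⟩ | ⟨i, w, rfl⟩ <;> rcases T.cover z' with ⟨x', rfl⟩ | ⟨i', w', rfl⟩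
    · rw [T.Rinl, T.Rinl] at h1'
      rw [h1']
    · have := (ext2 i' x none).symm.trans ((h2 i' none).trans (ext1 i' w' none))
      exact (zero_ne_one this).elim
    · have := (ext1 i w none).symm.trans ((h2 i none).trans (ext2 i x' none))
      exact (one_ne_zero this).elim
    · by_cases hii : i = i'
      · subst hii
        congr 1
        apply hj i
        funext γ
        exact (ext1 i w (some γ)).symm.trans ((h2 i (some γ)).trans (ext1 i w' (some γ)))
      · have := (ext1 i w none).symm.trans ((h2 i none).trans (ext3 i i' w' none hii))
        exact (one_ne_zero this).elim
  · intro z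
    rcases T.cover z with ⟨x, rfl⟩ | ⟨i, w, rfl⟩
    · refine ((hs (T.R (T.inl x))).image Sum.inl).mono ?_
      rintro (γ | ⟨i, o⟩) h
      · exact ⟨γ, h, rfl⟩
      · exact (h (ext2 i x o)).elim
    · have hc : (Set.range (fun o : Option {γ | d i w γ ≠ 0} =>
          (⟨i, o.map Subtype.val⟩ : Σ i, Option (Δ i)))).Countable := by
        have := (ht i w).to_subtype
        exact Set.countable_range _
      refine (((hs (T.R (T.inn i w))).image Sum.inl).union (hc.image Sum.inr)).mono ?_
      rintro (γ | ⟨j, o⟩) h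
      · exact Or.inl ⟨γ, h, rfl⟩
      · right
        refine ⟨_, ?_, rfl⟩
        by_cases hij : j = i
        · subst hij
          cases o with
          | none => exact ⟨none, rfl⟩
          | some γ =>
            have h' : Function.extend (T.inn j) (φ j (some γ)) 0 (T.inn j w) ≠ 0 := h
            have h2 : d j w γ ≠ 0 := fun h3 => h' ((ext1 j w (some γ)).trans h3)
            exact ⟨some ⟨γ, h2⟩, rfl⟩
        · exact (h (ext3 j i w o hij)).elim
end TD

theorem TData.LIndLE_upper {L : Type} [MetricSpace L] [CompactSpace L] [Nonempty L] (hL : NE L)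
    {X : Type} [TopologicalSpace X] [CompactSpace X] [T2Space X] {ι : Type}
    {W : ι → Type} [∀ i, TopologicalSpace (W i)] [∀ i, CompactSpace (W i)]
    {r : ∀ i, W i → X} {Z : Type} [TopologicalSpace Z] [CompactSpace Z] [T2Space Z]
    (T : TData r Z) {γ α : Ordinal.{0}} (hγ : γ < α) (hX : LIndLE L X γ)
    (hW : ∀ i, LIndLE L (W i) α)
    (H0 : ∀ A B : Set X, IsClosed A → IsOpen B → A ⊆ B → ∀ i, ∃ D : Set (W i), IsClopen D ∧
      r i ⁻¹' A ⊆ D ∧ D ⊆ r i ⁻¹' B) : LIndLE L Z α := by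
  rw [LIndLE_iff]
  intro F hF f hf
  obtain ⟨V, hV, hFV, gV, hgV, hgVf⟩ := hL Z F hF f hf
  obtain ⟨O', hO', hFO', hO'V⟩ := normal_exists_closure_subset (hF.preimage T.cinl)
    (hV.preimage T.cinl) (preimage_mono hFV)
  obtain ⟨O, hO, hFO, hOO'⟩ := normal_exists_closure_subset (hF.preimage T.cinl) hO' hFO'
  have hD := H0 (closure O) O' isClosed_closure hO' hOO'
  choose D hDc hD1 hD2 using hD
  have hE1 := T.finite (F := F \ T.R ⁻¹' O) (hF.sdiff (hO.preimage T.cR)) (by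
    intro x hx
    apply hx.2
    show T.R (T.inl x) ∈ O
    rw [T.Rinl]
    exact hFO hx.1)
  have hE2 := T.finite (F := T.R ⁻¹' (closure O') \ V) ((isClosed_closure.preimage T.cR).sdiff hV) (by
    intro x hx
    apply hx.2
    have : T.R (T.inl x) ∈ closure O' := hx.1
    rw [T.Rinl] at this
    exact hO'V this)
  let E : Set ι := {i | ∃ w, T.inn i w ∈ F \ T.R ⁻¹' O} ∪ {i | ∃ w, T.inn i w ∈ T.R ⁻¹' (closure O') \ V}
  have hE : E.Finite := hE1.union hE2
  have : Finite E := hE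
  let tJ : TopologicalSpace (Option E) := ⊥
  have : DiscreteTopology (Option E) := ⟨rfl⟩
  let κ : Z → Option E := fun z => if h : ∃ i : E, z ∈ Set.range (T.inn i.1) then some h.choose else none
  have hκs : ∀ i : E, κ ⁻¹' {some i} = Set.range (T.inn i.1) := by
    intro i
    ext z
    constructor
    · intro hz
      have hz' : κ z = some i := hz
      by_cases h : ∃ i : E, z ∈ Set.range (T.inn i.1)
      · simp only [κ, dif_pos h] at hz'
        have := h.choose_spec
        rw [Option.some.inj hz'] at this
        exact this
      · simp only [κ, dif_neg h] at hz'
        cases hz'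
    · intro hz
      have h : ∃ i : E, z ∈ Set.range (T.inn i.1) := ⟨i, hz⟩
      show κ z = some i
      simp only [κ, dif_pos h]
      congr 1
      obtain ⟨v, hv⟩ := h.choose_spec
      obtain ⟨w, hw⟩ := hz
      exact Subtype.ext (T.ne' _ _ _ _ (hv.trans hw.symm))
  have hκn : κ ⁻¹' {none} = ⋂ i ∈ E, (Set.range (T.inn i))ᶜ := by
    ext z
    simp only [mem_iInter]
    constructor
    · intro hz i hi hzi
      have : z ∈ κ ⁻¹' {some ⟨i, hi⟩} := by rw [hκs]; exact hzi
      have h1 : κ z = none := hz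
      have h2 : κ z = some ⟨i, hi⟩ := this
      rw [h1] at h2
      cases h2
    · intro hz
      show κ z = none
      have h : ¬ ∃ i : E, z ∈ Set.range (T.inn i.1) := fun ⟨i, hi⟩ => hz i i.2 hi
      simp only [κ, dif_neg h]
  have hNo : IsOpen (κ ⁻¹' {none}) := by
    rw [hκn]
    exact hE.isOpen_biInter fun i _ => (T.clop i).compl.isOpen
  have hκ : Continuous κ := by
    rw [continuous_discrete_rng]
    rintro (_ | i)
    · exact hNo
    · rw [hκs]; exact T.op i
  have hinlN : ∀ x, T.inl x ∈ κ ⁻¹' {none} := by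
    intro x
    rw [hκn]
    simp only [mem_iInter]
    rintro i _ ⟨w, hw⟩
    exact T.ne _ _ _ hw.symm
  have hinnN : ∀ i w, T.inn i w ∈ κ ⁻¹' {none} → i ∉ E := by
    intro i w h hi
    rw [hκn] at h
    exact (mem_iInter₂.1 h i hi) ⟨w, rfl⟩
  have hinnN' : ∀ i w, i ∉ E → T.inn i w ∈ κ ⁻¹' {none} := by
    intro i w h
    rw [hκn]
    simp only [mem_iInter]
    rintro j hj ⟨v, hv⟩
    exact h (T.ne' _ _ _ _ hv ▸ hj)
  apply partition_sum hκ F f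
  rintro (_ | i)
  · let U : Set Z := T.R ⁻¹' O ∪ ⋃ i, Set.range (T.inn i)
    have hU : IsOpen U := (hO.preimage T.cR).union (isOpen_iUnion T.op)
    let S : Set Z := {z | (∃ x ∈ O, T.inl x = z) ∨ ∃ i, ∃ w ∈ D i, T.inn i w = z}
    obtain ⟨l0⟩ := ‹Nonempty L›
    let g : Z → L := fun z => if z ∈ S then gV z else l0
    have inlS : ∀ x ∈ O, T.inl x ∈ S := fun x hx => Or.inl ⟨x, hx, rfl⟩
    have innS : ∀ i, ∀ w ∈ D i, T.inn i w ∈ S := fun i w hw => Or.inr ⟨i, w, hw, rfl⟩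
    have innS' : ∀ i, ∀ w ∉ D i, T.inn i w ∉ S := by
      rintro i w hw (⟨x, _, hx⟩ | ⟨j, v, hv, hj⟩)
      · exact T.ne _ _ _ hx
      · have := T.ne' _ _ _ _ hj
        subst this
        exact hw (T.inj _ hj ▸ hv)
    have innV : ∀ i, i ∉ E → ∀ w, r i w ∈ closure O' → T.inn i w ∈ V := by
      intro i hi w hw
      by_contra hV'
      exact hi (Or.inr ⟨w, by show T.R (T.inn i w) ∈ closure O'; rw [T.Rinn]; exact hw, hV'⟩)
    have loc : ∀ Q : Set Z, IsOpen Q → Q ⊆ V → Q ⊆ S → ∀ z ∈ Q, ContinuousAt g z := by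
      intro Q hQ hQV hQS z hz
      refine (hgV.continuousAt (hV.mem_nhds (hQV hz))).congr ?_
      filter_upwards [hQ.mem_nhds hz] with y hy
      simp only [g, if_pos (hQS hy)]
    refine ⟨U, hU, ?_, g, ?_, ?_, ?_⟩
    · rintro z ⟨hzF, hzN⟩
      rcases T.cover z with ⟨x, rfl⟩ | ⟨i, w, rfl⟩
      · left
        show T.R (T.inl x) ∈ O
        rw [T.Rinl]
        exact hFO hzF
      · right
        exact mem_iUnion.2 ⟨i, w, rfl⟩
    · rintro z ⟨hzU, hzN⟩
      apply ContinuousAt.continuousWithinAt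
      rcases T.cover z with ⟨x, rfl⟩ | ⟨i, w, rfl⟩
      · have hxO : T.R (T.inl x) ∈ O := by
          rcases hzU with h | h
          · exact h
          · obtain ⟨i, w, hw⟩ := mem_iUnion.1 h
            exact (T.ne _ _ _ hw.symm).elim
        refine loc (T.R ⁻¹' O ∩ κ ⁻¹' {none}) ((hO.preimage T.cR).inter hNo) ?_ ?_ _ ⟨hxO, hzN⟩
        · rintro z ⟨hz1, hz2⟩
          have hz1' : T.R z ∈ O := hz1
          rcases T.cover z with ⟨y, rfl⟩ | ⟨i, w, rfl⟩
          · rw [T.Rinl] at hz1'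
            exact hO'V (subset_closure (hOO' (subset_closure hz1')))
          · rw [T.Rinn] at hz1'
            exact innV i (hinnN i w hz2) w (subset_closure (hOO' (subset_closure hz1')))
        · rintro z ⟨hz1, hz2⟩
          have hz1' : T.R z ∈ O := hz1
          rcases T.cover z with ⟨y, rfl⟩ | ⟨i, w, rfl⟩
          · rw [T.Rinl] at hz1'
            exact inlS y hz1'
          · rw [T.Rinn] at hz1'
            exact innS i w (hD1 i (subset_closure hz1'))
      · have hi := hinnN i w hzN
        by_cases hw : w ∈ D i
        · refine loc (T.inn i '' D i) ((T.einno i).isOpenMap _ (hDc i).isOpen) ?_ ?_ _ ⟨w, hw, rfl⟩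
          · rintro _ ⟨v, hv, rfl⟩
            exact innV i hi v (subset_closure (hD2 i hv))
          · rintro _ ⟨v, hv, rfl⟩
            exact innS i v hv
        · refine (continuousAt_const (y := l0)).congr ?_
          filter_upwards [((T.einno i).isOpenMap _ (hDc i).compl.isOpen).mem_nhds ⟨w, hw, rfl⟩]
          rintro _ ⟨v, hv, rfl⟩
          simp only [g, if_neg (innS' i v hv)]
    · rintro z ⟨hzF, hzN⟩
      have hzS : z ∈ S := by
        rcases T.cover z with ⟨x, rfl⟩ | ⟨i, w, rfl⟩
        · exact inlS x (hFO hzF)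
        · refine innS i w (hD1 i (subset_closure ?_))
          have hi := hinnN i w hzN
          by_contra hO2
          exact hi (Or.inl ⟨w, hzF, by show T.R (T.inn i w) ∉ O; rw [T.Rinn]; exact hO2⟩)
      simp only [g, if_pos hzS]
      exact hgVf hzF
    · right
      refine ⟨γ, hγ, ?_⟩
      have hcl : IsClosed (κ ⁻¹' {none} \ U) :=
        ((isClosed_discrete _).preimage hκ).sdiff hU
      have : CompactSpace ↥(κ ⁻¹' {none} \ U) := isCompact_iff_compactSpace.1 hcl.isCompact
      have hin : ∀ z ∈ κ ⁻¹' {none} \ U, T.inl (T.R z) = z := by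
        rintro z ⟨_, hz⟩
        rcases T.cover z with ⟨x, rfl⟩ | ⟨i, w, rfl⟩
        · rw [T.Rinl]
        · exact (hz (Or.inr (mem_iUnion.2 ⟨i, w, rfl⟩))).elim
      refine hX.of_emb (e := fun z : ↥(κ ⁻¹' {none} \ U) => T.R z.1)
        ((T.cR.comp continuous_subtype_val).isClosedEmbedding ?_)
      rintro ⟨a, ha⟩ ⟨b, hb⟩ hab
      apply Subtype.ext
      have hab' : T.R a = T.R b := hab
      show a = b
      rw [← hin a ha, ← hin b hb, hab']
  · rw [hκs]
    exact (hW i).push (T.einn i) hF f (hf.mono inter_subset_left)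

open Filter in
theorem exists_obstruction {X L : Type} [TopologicalSpace X] [FrechetUrysohnSpace X] [MetricSpace L]
    {U : Set X} {g : X → L} (hg : ContinuousOn g U)
    (h : ¬ ∃ g' : X → L, ContinuousOn g' (closure U) ∧ EqOn g' g U) :
    ∃ (s : ℕ → X) (x : X), (∀ k, s k ∈ U) ∧ Tendsto s atTop (𝓝 x) ∧
      ¬ ∃ y, Tendsto (fun k => g (s k)) atTop (𝓝 y) := by
  by_contra hcon
  push Not at hcon
  apply h
  refine ⟨extendFrom U g, continuousOn_extendFrom subset_rfl ?_, ?_⟩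
  · intro x hx
    obtain ⟨s, hs, hsx⟩ := mem_closure_iff_seq_limit.1 hx
    obtain ⟨y, hy⟩ := hcon s x hs hsx
    refine ⟨y, ?_⟩
    by_contra hn
    rw [Filter.tendsto_def] at hn
    push Not at hn
    obtain ⟨N, hN, hgN⟩ := hn
    have hxc : x ∈ closure {z | z ∈ U ∧ g z ∉ N} := by
      by_contra hxn
      apply hgN
      rw [mem_nhdsWithin]
      refine ⟨(closure {z | z ∈ U ∧ g z ∉ N})ᶜ, isClosed_closure.isOpen_compl, hxn, ?_⟩
      rintro z ⟨hz1, hz2⟩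
      by_contra hz3
      exact hz1 (subset_closure ⟨hz2, hz3⟩)
    obtain ⟨t, ht, htx⟩ := mem_closure_iff_seq_limit.1 hxc
    let u : ℕ → X := fun k => if Even k then s (k / 2) else t (k / 2)
    have hdiv : Tendsto (fun k : ℕ => k / 2) atTop atTop :=
      Nat.tendsto_div_const_atTop (by norm_num)
    have hu : Tendsto u atTop (𝓝 x) := by
      have h1 := hsx.comp hdiv
      have h2 := htx.comp hdiv
      rw [tendsto_def] at h1 h2 ⊢
      intro M hM
      filter_upwards [h1 M hM, h2 M hM] with k hk1 hk2
      show u k ∈ M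
      by_cases hk : Even k
      · simp only [u, if_pos hk]; exact hk1
      · simp only [u, if_neg hk]; exact hk2
    obtain ⟨y', hy'⟩ := hcon u x (by
      intro k
      by_cases hk : Even k
      · simp only [u, if_pos hk]; exact hs _
      · simp only [u, if_neg hk]; exact (ht _).1) hu
    have t1 : Tendsto (fun k : ℕ => 2 * k) atTop atTop :=
      tendsto_atTop_mono (fun k => by simp only [id]; omega) tendsto_id
    have t2 : Tendsto (fun k : ℕ => 2 * k + 1) atTop atTop :=
      tendsto_atTop_mono (fun k => by simp only [id]; omega) tendsto_id
    have e1 : ∀ k, u (2 * k) = s k := by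
      intro k
      have : Even (2 * k) := even_two_mul k
      simp only [u, if_pos this]
      congr 1; omega
    have e2 : ∀ k, u (2 * k + 1) = t k := by
      intro k
      have : ¬ Even (2 * k + 1) := by simp
      simp only [u, if_neg this]
      congr 1; omega
    have l1 : Tendsto (fun k => g (s k)) atTop (𝓝 y') := by
      have := hy'.comp t1
      refine this.congr (fun k => ?_)
      simp only [Function.comp, e1]
    have hyy := tendsto_nhds_unique l1 hy
    have l2 : Tendsto (fun k => g (t k)) atTop (𝓝 y) := by
      have := hy'.comp t2
      rw [hyy] at this
      refine this.congr (fun k => ?_)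
      simp only [Function.comp, e2]
    obtain ⟨k, hk⟩ := (l2.eventually hN).exists
    exact (ht k).2 hk
  · intro x hx
    exact extendFrom_eq (subset_closure hx) (hg x hx)

/-- The properties maintained along the transfinite induction. -/
def Good (L C : Type) [TopologicalSpace L] [TopologicalSpace C] (α : Ordinal.{0}) (X : Type)
    [TopologicalSpace X] : Prop :=
  CompactSpace X ∧ T2Space X ∧ Nonempty X ∧ Corson X ∧
    (∀ x : X, Nonempty (connectedComponent x ≃ₜ C)) ∧ LIndLE L X α ∧
    (∀ β < α, ¬ LIndLE L X β) ∧ Strong L X α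

open Filter in
theorem succ_step {L : Type} [MetricSpace L] [CompactSpace L] [Nonempty L] (hL : NE L)
    {C : Type} [TopologicalSpace C] {X : Type} [TopologicalSpace X] {η : Ordinal.{0}}
    (hX : Good L C η X) :
    ∃ (Z : Type) (tZ : TopologicalSpace Z), @Good L C _ _ (Order.succ η) Z tZ := by
  obtain ⟨h1, h2, h3, h4, h5, h6, h7, F, hF, f, hf, hS⟩ := hX
  have hFr := h4.frechet
  let r : ∀ i : C(OnePoint ℕ, X) × ℝ, OnePoint ℕ × X → X := fun i p => i.1 p.1
  have hr : ∀ i, Continuous (r i) := fun i => i.1.continuous.comp continuous_fst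
  obtain ⟨Z, tZ, hc, ht, ⟨T⟩⟩ := exists_TData (W := fun _ : C(OnePoint ℕ, X) × ℝ => OnePoint ℕ × X) r hr
  have hle : LIndLE L Z (Order.succ η) := by
    refine T.LIndLE_upper hL (Order.lt_succ η) h6
      (fun i => (LIndLE_prod hL h6).mono (Order.le_succ η)) ?_
    intro A B hA hB hAB i
    obtain ⟨D, hD, hD1, hD2⟩ := exists_clopen_of_closed_subset_open (hA.preimage i.1.continuous)
      (hB.preimage i.1.continuous) (preimage_mono hAB)
    refine ⟨Prod.fst ⁻¹' D, hD.preimage continuous_fst, ?_, ?_⟩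
    · exact fun p hp => hD1 hp
    · exact fun p hp => hD2 hp
  have hn : ¬ LIndLE L Z η := by
    intro hlt
    rw [LIndLE_iff] at hlt
    obtain ⟨f', hf', hff⟩ := exists_push T.einl.isEmbedding hf
    obtain ⟨U, hU, hFU, g, hg, hgf, hP⟩ := hlt (T.inl '' F) (T.einl.isClosedMap _ hF) f' hf'
    have hgX : ContinuousOn (g ∘ T.inl) (T.inl ⁻¹' U) :=
      hg.comp T.cinl.continuousOn (fun x hx => hx)
    have hcl : IsClosed ((T.inl ⁻¹' U)ᶜ) := (hU.preimage T.cinl).isClosed_compl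
    have hno := hS (T.inl ⁻¹' U) (hU.preimage T.cinl) (fun x hx => hFU ⟨x, hx, rfl⟩) (g ∘ T.inl) hgX
      (fun x hx => by
        have := hgf ⟨x, hx, rfl⟩
        rw [hff] at this
        exact this)
      (hP.of_sub (e := fun x : ↥((T.inl ⁻¹' U)ᶜ) => T.inl x.1)
        (T.einl.comp hcl.isClosedEmbedding_subtypeVal) (fun x => x.2))
    obtain ⟨s, x, hs, hsx, hd⟩ := exists_obstruction hgX hno
    let σ : C(OnePoint ℕ, X) := OnePoint.continuousMapMkNat s x hsx
    have hσ : ∀ k : ℕ, σ (k : OnePoint ℕ) = s k := fun k => rfl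
    let K : ℕ → ℕ → Set Z := fun k m => T.R ⁻¹' {s k} \
      (U ∩ g ⁻¹' Metric.ball (g (T.inl (s k))) (1 / ((m : ℝ) + 1)))
    have hK : ∀ k m, {i | ∃ w, T.inn i w ∈ K k m}.Finite := by
      intro k m
      refine T.finite ((isClosed_singleton.preimage T.cR).sdiff
        (hg.isOpen_inter_preimage hU Metric.isOpen_ball)) ?_
      rintro y ⟨hy1, hy2⟩
      have hy1' : T.R (T.inl y) = s k := hy1
      rw [T.Rinl] at hy1'
      subst hy1'
      exact hy2 ⟨hs k, Metric.mem_ball_self (by positivity)⟩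
    have hB : (⋃ k, ⋃ m, {i | ∃ w, T.inn i w ∈ K k m}).Countable :=
      Set.countable_iUnion fun k => Set.countable_iUnion fun m => (hK k m).countable
    obtain ⟨ρ, hρ⟩ : ∃ ρ : ℝ, (σ, ρ) ∉ ⋃ k, ⋃ m, {i | ∃ w, T.inn i w ∈ K k m} := by
      by_contra hall
      push Not at hall
      have : (Set.univ : Set ℝ).Countable := by
        refine (hB.preimage (f := fun ρ : ℝ => (σ, ρ)) (fun a b hab => (Prod.ext_iff.1 hab).2)).mono ?_
        intro ρ _
        exact hall ρ
      exact Cardinal.not_countable_real this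
    have hgood : ∀ (k : ℕ) (y : X), T.inn (σ, ρ) ((k : OnePoint ℕ), y) ∈ U ∧
        g (T.inn (σ, ρ) ((k : OnePoint ℕ), y)) = g (T.inl (s k)) := by
      intro k y
      have hm : ∀ m : ℕ, T.inn (σ, ρ) ((k : OnePoint ℕ), y) ∈
          U ∩ g ⁻¹' Metric.ball (g (T.inl (s k))) (1 / ((m : ℝ) + 1)) := by
        intro m
        by_contra hcon
        apply hρ
        refine mem_iUnion.2 ⟨k, mem_iUnion.2 ⟨m, _, ?_, hcon⟩⟩
        show T.R _ = s k
        rw [T.Rinn]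
        exact hσ k
      refine ⟨(hm 0).1, ?_⟩
      by_contra hne
      have hpos := dist_pos.2 hne
      obtain ⟨m, hm'⟩ := exists_nat_one_div_lt hpos
      have := (hm m).2
      have h9 : dist (g (T.inn (σ, ρ) ((k : OnePoint ℕ), y))) (g (T.inl (s k))) < 1 / ((m : ℝ) + 1) := this
      exact lt_asymm hm' h9
    have hinf : ∀ y : X, T.inn (σ, ρ) (OnePoint.infty, y) ∈ Uᶜ := by
      intro y hy
      apply hd
      refine ⟨g (T.inn (σ, ρ) (OnePoint.infty, y)), ?_⟩
      have hcont := hg.continuousAt (hU.mem_nhds hy)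
      have htend : Tendsto (fun k : ℕ => (k : OnePoint ℕ)) atTop (𝓝 OnePoint.infty) := by
        have := OnePoint.tendsto_coe_infty (X := ℕ)
        rwa [coclosedCompact_eq_cocompact, cocompact_eq_cofinite, Nat.cofinite_eq_atTop] at this
      have h8 : Tendsto (fun k : ℕ => T.inn (σ, ρ) ((k : OnePoint ℕ), y)) atTop
          (𝓝 (T.inn (σ, ρ) (OnePoint.infty, y))) :=
        ((T.cinn (σ, ρ)).tendsto _).comp (htend.prodMk_nhds tendsto_const_nhds)
      refine (hcont.tendsto.comp h8).congr ?_
      intro k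
      exact (hgood k y).2
    have hXlt : LIndLT L X η := hP.of_sub (e := fun y : X => T.inn (σ, ρ) (OnePoint.infty, y))
      (((T.cinn _).comp (by fun_prop)).isClosedEmbedding (by
        intro a b hab
        exact (Prod.ext_iff.1 (T.inj _ hab)).2)) hinf
    rcases hXlt with h | ⟨β, hβ, h⟩
    · exact not_isEmpty_of_nonempty X h
    · exact h7 β hβ h
  refine ⟨Z, tZ, hc, ht, h3.map T.inl, T.corson h4 (fun _ => Corson_onePoint.prod h4),
    T.comps h5 (fun _ => prod_comps h5), hle, ?_, Strong_succ hn⟩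
  intro β hβ h
  exact hn (h.mono (Order.lt_succ_iff.1 hβ))

theorem limit_step {L : Type} [MetricSpace L] [CompactSpace L] [Nonempty L] (hL : NE L)
    {C : Type} [MetricSpace C] [CompactSpace C] [ConnectedSpace C] {n l : Ordinal.{0}}
    (hl : Order.IsSuccLimit l) (hn : n < l) (hC : LIndLE L C n) (hE : ¬ EP L C)
    (ih : ∀ β < l, n ≤ β → ∃ (X : Type) (tX : TopologicalSpace X), @Good L C _ _ β X tX) :
    ∃ (Z : Type) (tZ : TopologicalSpace Z), @Good L C _ _ l Z tZ := by
  have ih' : ∀ b : l.ToType, ∃ (X : Type) (tX : TopologicalSpace X),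
      @Good L C _ _ (max n (Ordinal.ToType.mk.symm b).1) X tX := fun b =>
    ih _ (max_lt hn (Ordinal.ToType.mk.symm b).2) (le_max_left _ _)
  choose Y tY hY using ih'
  let ι := l.ToType × C × ℕ
  let W : ι → Type := fun i => Y i.1
  let tW : ∀ i, TopologicalSpace (W i) := fun i => tY i.1
  have cW : ∀ i, CompactSpace (W i) := fun i => (hY i.1).1
  have sW : ∀ i, T2Space (W i) := fun i => (hY i.1).2.1
  let r : ∀ i, W i → C := fun i _ => i.2.1
  obtain ⟨Z, tZ, hc, ht, ⟨T⟩⟩ := exists_TData (W := W) r (fun i => continuous_const)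
  have hCc : ∀ x : C, Nonempty (connectedComponent x ≃ₜ C) := fun x =>
    ⟨(Homeomorph.setCongr (PreconnectedSpace.connectedComponent_eq_univ x)).trans (Homeomorph.Set.univ C)⟩
  have big : ∀ β < l, ∃ b : l.ToType, ∀ i : ι, i.1 = b → ¬ LIndLE L (W i) β := by
    intro β hβ
    refine ⟨Ordinal.ToType.mk ⟨Order.succ β, hl.succ_lt hβ⟩, ?_⟩
    rintro ⟨b, c, k⟩ hb
    refine (hY b).2.2.2.2.2.2.1 β (lt_of_lt_of_le (Order.lt_succ β) (le_max_of_le_right ?_))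
    have hb' : b = Ordinal.ToType.mk ⟨Order.succ β, hl.succ_lt hβ⟩ := hb
    rw [hb', OrderIso.symm_apply_apply]
  have hpos : (0 : Ordinal.{0}) < l := lt_of_le_of_lt zero_le hn
  refine ⟨Z, tZ, hc, ht, (inferInstance : Nonempty C).map T.inl,
    T.corson (Corson_of_EmbR (EmbR_of_metric C)) (fun i => (hY i.1).2.2.2.1),
    T.comps hCc (fun i => (hY i.1).2.2.2.2.1), ?_, ?_, ?_⟩
  · refine T.LIndLE_upper hL hn hC (fun i => ((hY i.1).2.2.2.2.2.1).mono
      (max_le hn.le (Ordinal.ToType.mk.symm i.1).2.le)) ?_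
    intro A B hA hB hAB i
    by_cases hcA : i.2.1 ∈ A
    · exact ⟨Set.univ, isClopen_univ, fun _ _ => trivial, fun _ _ => hAB hcA⟩
    · exact ⟨∅, isClopen_empty, fun _ h => (hcA h).elim, empty_subset _⟩
  · intro β hβ h
    obtain ⟨b, hb⟩ := big β hβ
    exact hb (b, Classical.arbitrary C, 0) rfl (h.of_emb (T.einn _))
  · unfold EP at hE
    push Not at hE
    obtain ⟨F, hF, f, hf, hno⟩ := hE
    obtain ⟨f', hf', hff⟩ := exists_push T.einl.isEmbedding hf
    refine ⟨T.inl '' F, T.einl.isClosedMap _ hF, f', hf', ?_⟩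
    rintro U hU hFU g hg hgf hP ⟨g', hg', hgg⟩
    obtain ⟨β, hβ, hPβ⟩ : ∃ β < l, LIndLE L (↥(Uᶜ)) β := by
      rcases hP with hP | hP
      · exact ⟨0, hpos, LIndLE_of_isEmpty 0⟩
      · exact hP
    have hcl : ∀ c, T.inl c ∈ closure U := by
      intro c
      by_contra hcn
      have hfin := T.finite (F := closure U ∩ T.R ⁻¹' {c})
        (isClosed_closure.inter (isClosed_singleton.preimage T.cR)) (by
          rintro x ⟨hx1, hx2⟩
          have hx2' : T.R (T.inl x) = c := hx2
          rw [T.Rinl] at hx2'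
          rw [hx2'] at hx1
          exact hcn hx1)
      obtain ⟨b, hb⟩ := big β hβ
      obtain ⟨k, hk⟩ : ∃ k : ℕ, ((b, c, k) : ι) ∉ {i | ∃ w, T.inn i w ∈ closure U ∩ T.R ⁻¹' {c}} := by
        by_contra hall
        push Not at hall
        have hinj : Function.Injective (fun k : ℕ => ((b, c, k) : ι)) := by
          intro a a' h
          simpa [ι] using h
        exact Set.infinite_of_injective_forall_mem hinj hall hfin
      refine hb (b, c, k) rfl (hPβ.of_sub (T.einn (b, c, k)) ?_)
      intro w hw
      refine hk ⟨w, subset_closure hw, ?_⟩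
      show T.R _ = c
      rw [T.Rinn]
    refine hno (g' ∘ T.inl) ?_ ?_
    · exact hg'.comp_continuous T.cinl hcl
    · intro x hx
      show g' (T.inl x) = f x
      rw [hgg (hFU ⟨x, hx, rfl⟩), hgf ⟨x, hx, rfl⟩, hff]

theorem nonempty_of_joinPow {L : Type} [TopologicalSpace L] (n : ℕ) (h : Nonempty (JoinPow L n)) :
    Nonempty L := by
  cases n with
  | zero => exact h
  | succ n =>
    obtain ⟨q⟩ := h
    exact Quot.ind (β := fun _ => Nonempty L) (fun p => ⟨p.1⟩) q

theorem main_induction {L : Type} [MetricSpace L] [CompactSpace L] [Nonempty L] (hL : NE L)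
    {C : Type} [MetricSpace C] [CompactSpace C] [ConnectedSpace C] {n : ℕ} (hn : 1 ≤ n)
    (hC : LIndLE L C (n : Ordinal.{0})) (hC' : ∀ k < n, ¬ LIndLE L C (k : Ordinal.{0}))
    (α : Ordinal.{0}) (hα : (n : Ordinal.{0}) ≤ α) :
    ∃ (Z : Type) (tZ : TopologicalSpace Z), @Good L C _ _ α Z tZ := by
  induction α using WellFoundedLT.induction with
  | ind α ih =>
    rcases hα.eq_or_lt with h | h
    · subst h
      refine ⟨C, inferInstance, inferInstance, inferInstance, inferInstance,
        Corson_of_EmbR (EmbR_of_metric C), fun x =>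
        ⟨(Homeomorph.setCongr (PreconnectedSpace.connectedComponent_eq_univ x)).trans
          (Homeomorph.Set.univ C)⟩, hC, ?_, ?_⟩
      · intro β hβ
        obtain ⟨k, rfl⟩ := Ordinal.lt_omega0.1 (hβ.trans (Ordinal.natCast_lt_omega0 n))
        exact hC' k (by exact_mod_cast hβ)
      · obtain ⟨m, rfl⟩ := Nat.exists_eq_succ_of_ne_zero (by omega : n ≠ 0)
        have := Strong_succ (hC' m (Nat.lt_succ_self m))
        rwa [Nat.succ_eq_add_one, Nat.cast_add_one, ← Order.succ_eq_add_one]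
    · rcases Ordinal.zero_or_succ_or_isSuccLimit α with h0 | ⟨η, rfl⟩ | hlim
      · rw [h0] at h
        exact (not_lt_bot h).elim
      · obtain ⟨X, tX, hX⟩ := ih η (Order.lt_succ η) (Order.lt_succ_iff.1 h)
        exact succ_step hL hX
      · refine limit_step hL hlim h hC ?_ (fun β hβ hnβ => ih β hβ hnβ)
        intro hE
        exact hC' 0 (by omega) (LIndLE_of_EP hE _)

theorem final14 (L : Type) [MetricSpace L] [CompactSpace L]
    (hANR : IsANR L)
    (C : Type) [MetricSpace C] [CompactSpace C] [ConnectedSpace C]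
    (n : ℕ) (hn : 1 ≤ n) (hdim : LDim L C = Dim.ofOrdinal ((n : ℕ) : Ordinal.{0}))
    (α : Ordinal.{0}) (hα : (n : Ordinal.{0}) ≤ α) :
    ∃ (X : Type) (tX : TopologicalSpace X),
      letI := tX
      CompactSpace X ∧ T2Space X ∧ FrechetUrysohnSpace X ∧
      LDim L X = Dim.ofOrdinal ((n : ℕ) : Ordinal.{0}) ∧
      LInd L X = Dim.ofOrdinal α ∧
      ∀ x : X, Nonempty (↥(connectedComponent x) ≃ₜ C) := by
  obtain ⟨hd1, hd2⟩ := LDim_spec L C hdim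
  have hLne : Nonempty L := by
    obtain ⟨g, -⟩ := hd1 ∅ isClosed_empty ⟨fun x => x.2.elim,
      continuous_of_discreteTopology⟩
    exact nonempty_of_joinPow n ⟨g (Classical.arbitrary C)⟩
  have hNE := NE_of_IsANR L hANR
  have h1 := EmbR_of_metric L
  have h2 := ME_of_NE hNE
  have hJ : ∀ k, Nonempty (JoinPow L k) := fun k => (joinPow_props L h1 h2 k).2.1
  obtain ⟨X, tX, g1, g2, g3, g4, g5, g6, g7, -⟩ := main_induction hNE hn
    (LIndLE_of_EP_metric h1 h2 n ((LDimLE_iff L C n).1 hd1))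
    (fun k hk h => hd2 k hk ((LDimLE_iff L C k).2 (EP_of_LIndLE h1 h2 k h))) α hα
  refine ⟨X, tX, g1, g2, g4.frechet, ?_, LInd_eq L X g6 g7, g5⟩
  rw [← hdim]
  apply LDim_congr
  intro k
  rw [LDimLE_iff, LDimLE_iff]
  exact EP_iff_of_components (joinPow_NE L h1 h2 k) g5


-- STATEMENT 14
theorem statement14 (L : Type) [MetricSpace L] [CompactSpace L]
    (hANR : IsANR L) (hL : ¬ContractibleSpace L)
    (C : Type) [MetricSpace C] [CompactSpace C] [ConnectedSpace C]
    (n : ℕ) (hn : 1 ≤ n) (hdim : LDim L C = Dim.ofOrdinal ((n : ℕ) : Ordinal.{0}))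
    (α : Ordinal.{0}) (hα : (n : Ordinal.{0}) ≤ α) :
    ∃ (X : Type) (tX : TopologicalSpace X),
      letI := tX
      CompactSpace X ∧ T2Space X ∧ FrechetUrysohnSpace X ∧
      LDim L X = Dim.ofOrdinal ((n : ℕ) : Ordinal.{0}) ∧
      LInd L X = Dim.ofOrdinal α ∧
      ∀ x : X, Nonempty (↥(connectedComponent x) ≃ₜ C) := by
  exact final14 L hANR C n hn hdim α hα

end
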